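/- With L : z = 0 the line at infinity: (1) the degree 16 curves C''₀ : f''₀ = 0 and C''₁ : f''₁ = 0 are minimal plus-one generated (MPOG) curves with exponents (8,8,9) and τ(C''₀) = τ(C''₁) = 167, while C''_{b''} : f''_{b''} = 0 is free with exponents (7,8) and τ(C''_{b''}) = 169; (2) the curve C''_{b''} ∪ L is free with exponents (7,9) and τ = 193, while C''₀ ∪ L and C''₁ ∪ L are nearly free with exponents (8,9) and τ = 191; (3) the curve C''₀ ∪ C''_{b''} is free with exponents (15,16) and τ = 721, and C''₀ ∪ C''_{b''} ∪ L is free with exponents (15,17) and τ = 769. -/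

import Mathlib

open MvPolynomial

noncomputable section

/-- `S = ℂ[x,y,z]`, with `x = X 0`, `y = X 1`, `z = X 2`. -/
abbrev S3 := MvPolynomial (Fin 3) ℂ

/-- The graded `S`-module `D_0(f)` of Jacobian syzygies of `f`. -/
def jacSyz (f : S3) : Submodule S3 (Fin 3 → S3) where
  carrier := {v | v 0 * pderiv 0 f + v 1 * pderiv 1 f + v 2 * pderiv 2 f = 0}
  add_mem' := by
    intro a b ha hb
    simp only [Set.mem_setOf_eq, Pi.add_apply] at *
    linear_combination ha + hb
  zero_mem' := by simp
  smul_mem' := by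
    intro c v hv
    simp only [Set.mem_setOf_eq, Pi.smul_apply, smul_eq_mul] at *
    linear_combination c * hv

/-- `v` is a minimal system of `m` homogeneous generators of `D_0(f)`, the generator
`v j` being a syzygy of degree `dd j`, and `dd` nondecreasing: this says that
`C : f = 0` is an `m`-syzygy curve with exponents `dd`. -/
structure IsMinGenSyz (f : S3) (m : ℕ) (dd : Fin m → ℕ) (v : Fin m → (Fin 3 → S3)) : Prop where
  mem : ∀ j, v j ∈ jacSyz f
  hom : ∀ j i, ((v j) i).IsHomogeneous (dd j)
  ne_zero : ∀ j, v j ≠ 0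
  span_eq : Submodule.span S3 (Set.range v) = jacSyz f
  minimal : ∀ j, v j ∉ Submodule.span S3 (v '' {j' | j' ≠ j})
  mono : Monotone dd

/-- `C : f = 0` is free with exponents `(d1, d2)`. -/
def IsFreeWith (f : S3) (d1 d2 : ℕ) : Prop := ∃ v, IsMinGenSyz f 2 ![d1, d2] v

/-- `C : f = 0` is a free curve (a 2-syzygy curve). -/
def IsFreeCurve (f : S3) : Prop := ∃ d1 d2, IsFreeWith f d1 d2

/-- `C : f = 0` of degree `d` is nearly free with exponents `(d1, d2)`:
a 3-syzygy curve with exponents `(d1, d2, d2)` and `d1 + d2 = d`. -/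
def IsNearlyFreeWith (f : S3) (d d1 d2 : ℕ) : Prop :=
  d1 + d2 = d ∧ ∃ v, IsMinGenSyz f 3 ![d1, d2, d2] v

/-- `C : f = 0` of degree `d` is a nearly free curve. -/
def IsNearlyFree (f : S3) (d : ℕ) : Prop := ∃ d1 d2, IsNearlyFreeWith f d d1 d2

/-- `C : f = 0` of degree `d` is plus-one generated with exponents `(d1, d2, d3)`:
a 3-syzygy curve with `d1 + d2 = d`. -/
def IsPOGWith (f : S3) (d d1 d2 d3 : ℕ) : Prop :=
  d1 + d2 = d ∧ ∃ v, IsMinGenSyz f 3 ![d1, d2, d3] v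

/-- `C : f = 0` of degree `d` is a plus-one generated curve. -/
def IsPOG (f : S3) (d : ℕ) : Prop := ∃ d1 d2 d3, IsPOGWith f d d1 d2 d3

/-- `C : f = 0` of degree `d` is minimal plus-one generated (MPOG),
with exponents `(d1, d2, d2 + 1)`. -/
def IsMPOGWith (f : S3) (d d1 d2 : ℕ) : Prop := IsPOGWith f d d1 d2 (d2 + 1)

/-- `C : f = 0` of degree `d` is an MPOG-curve. -/
def IsMPOG (f : S3) (d : ℕ) : Prop := ∃ d1 d2, IsMPOGWith f d d1 d2

/-- `r = mdr(f)`: the minimal degree of a nonzero (homogeneous) Jacobian relation for `f`. -/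
def IsMDR (f : S3) (r : ℕ) : Prop :=
  (∃ v ∈ jacSyz f, v ≠ 0 ∧ ∀ i, (v i).IsHomogeneous r) ∧
  ∀ m, m < r → ∀ v ∈ jacSyz f, (∀ i, (v i).IsHomogeneous m) → v = 0

/-- The Jacobian ideal `J_f` of `f`. -/
def jacobianIdeal (f : S3) : Ideal S3 := Ideal.span {pderiv 0 f, pderiv 1 f, pderiv 2 f}

/-- The dimension of the degree `k` graded piece of the Milnor algebra `M(f) = S/J_f`. -/
def milnorDim (f : S3) (k : ℕ) : ℕ :=
  Module.finrank ℂ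
    (↥(homogeneousSubmodule (Fin 3) ℂ k) ⧸
      (Submodule.comap (homogeneousSubmodule (Fin 3) ℂ k).subtype
        (Submodule.restrictScalars ℂ (jacobianIdeal f))))

/-- `τ` is the total Tjurina number of the reduced curve `C : f = 0`, i.e. the degree of the
Jacobian ideal `J_f`: for all large `k` one has `dim M(f)_k = τ`. -/
def IsTjurina (f : S3) (τ : ℕ) : Prop := ∀ᶠ k in Filter.atTop, milnorDim f k = τ

/-- `C : f = 0` is a maximal Tjurina curve of type `(d, r)`. -/
def IsMaxTjurina (f : S3) (d r : ℕ) : Prop :=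
  IsMDR f r ∧ d ≤ 2 * r ∧
  ∃ τ : ℕ, IsTjurina f τ ∧
    (τ : ℤ) = ((d : ℤ) - 1) ^ 2 - r * ((d : ℤ) - r - 1) - (Nat.choose (2 * r + 2 - d) 2 : ℤ)

/-- `f` is a product of `d` linear forms all vanishing at a common point, i.e.
`C : f = 0` is the union of `d` lines passing through one point. -/
def IsUnionOfConcurrentLines (f : S3) (d : ℕ) : Prop :=
  ∃ (c : ℂ) (L : Fin d → Fin 3 → ℂ) (v : Fin 3 → ℂ), v ≠ 0 ∧
    f = C c * ∏ j, (∑ i, C (L j i) * X i) ∧ ∀ j, (∑ i, L j i * v i) = 0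

/-- The ideal `I_θ` generated by the 2×2 minors of the matrix with rows `(x,y,z)` and
`(a,b,c)`, defining the eigenscheme `Γ_θ` of the derivation `θ = a ∂_x + b ∂_y + c ∂_z`. -/
def eigenIdeal (a b c : S3) : Ideal S3 :=
  Ideal.span {X 1 * c - X 2 * b, X 2 * a - X 0 * c, X 0 * b - X 1 * a}

/-- The projective plane `ℙ²(ℂ)`. -/
abbrev Pt := Projectivization ℂ (Fin 3 → ℂ)

/-- The eigenscheme `Γ_θ` of `θ = a ∂_x + b ∂_y + c ∂_z` is 0-dimensional:
its set of points in `ℙ²` is finite. -/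
def EigenSchemeFinite (a b c : S3) : Prop :=
  {p : Pt | eval p.rep (X 1 * c - X 2 * b) = 0 ∧ eval p.rep (X 2 * a - X 0 * c) = 0 ∧
      eval p.rep (X 0 * b - X 1 * a) = 0}.Finite

set_option maxHeartbeats 1000000 in
/-- The homogenization `f''₀` of the degree 16 Briançon-type polynomial `g''`. -/
def f0'' : S3 :=
  X 0 ^ 10 * X 1 ^ 6 + 6 * X 0 ^ 9 * X 1 ^ 5 * X 2 ^ 2 + 5 * X 0 ^ 8 * X 1 ^ 5 * X 2 ^ 3 +
    15 * X 0 ^ 8 * X 1 ^ 4 * X 2 ^ 4 + 25 * X 0 ^ 7 * X 1 ^ 4 * X 2 ^ 5 +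
    20 * X 0 ^ 7 * X 1 ^ 3 * X 2 ^ 6 + 10 * X 0 ^ 6 * X 1 ^ 4 * X 2 ^ 6 +
    50 * X 0 ^ 6 * X 1 ^ 3 * X 2 ^ 7 + 15 * X 0 ^ 6 * X 1 ^ 2 * X 2 ^ 8 +
    C (184 / 5 : ℂ) * X 0 ^ 5 * X 1 ^ 3 * X 2 ^ 8 + 50 * X 0 ^ 5 * X 1 ^ 2 * X 2 ^ 9 +
    10 * X 0 ^ 4 * X 1 ^ 3 * X 2 ^ 9 + 6 * X 0 ^ 5 * X 1 * X 2 ^ 10 +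
    C (252 / 5 : ℂ) * X 0 ^ 4 * X 1 ^ 2 * X 2 ^ 10 + 25 * X 0 ^ 4 * X 1 * X 2 ^ 11 +
    22 * X 0 ^ 3 * X 1 ^ 2 * X 2 ^ 11 + X 0 ^ 4 * X 2 ^ 12 +
    C (152 / 5 : ℂ) * X 0 ^ 3 * X 1 * X 2 ^ 12 + 5 * X 0 ^ 2 * X 1 ^ 2 * X 2 ^ 12 +
    5 * X 0 ^ 3 * X 2 ^ 13 + 14 * X 0 ^ 2 * X 1 * X 2 ^ 13 +
    C (34 / 5 : ℂ) * X 0 ^ 2 * X 2 ^ 14 + 4 * X 0 * X 1 * X 2 ^ 14 + 2 * X 0 * X 2 ^ 15 +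
    X 1 * X 2 ^ 15 - X 2 ^ 16

/-- `f''₁ = f''₀ - z¹⁶`. -/
def f1'' : S3 := f0'' - X 2 ^ 16

/-- `f''_{b''} = f''₀ + (64/25) z¹⁶`. -/
def fb'' : S3 := f0'' + C (64 / 25 : ℂ) * X 2 ^ 16

/-! ### Hilbert functions of graded pieces -/

instance homogeneousSubmodule_finite (n : ℕ) :
    Module.Finite ℂ (homogeneousSubmodule (Fin 3) ℂ n) :=
  Module.Finite.iff_fg.mpr (homogeneousSubmodule_fg _ _ n)

theorem finrank_homogeneousSubmodule (n : ℕ) :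
    Module.finrank ℂ (homogeneousSubmodule (Fin 3) ℂ n) = (n + 2).choose 2 := by
  have hset : {d : Fin 3 →₀ ℕ | d.degree = n} =
      ((Finset.univ : Finset (Fin 3)).finsuppAntidiag n : Set (Fin 3 →₀ ℕ)) := by
    ext d
    simp [Finset.mem_finsuppAntidiag, Finsupp.degree_eq_sum]
  rw [homogeneousSubmodule_eq_finsupp_supported, hset,
    (AddMonoidAlgebra.supportedEquivFinsupp _).finrank_eq, Module.finrank_finsupp_self]
  simp only [Finset.coe_sort_coe, Fintype.card_coe]
  rw [Finset.card_finsuppAntidiag_nat_eq_choose]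
  simpa [add_comm] using Nat.choose_symm_add (a := n) (b := 2)

theorem homogeneousComponent_mul_of_isHomogeneous {p q : S3} {n e N : ℕ}
    (hq : q.IsHomogeneous e) (h : n + e = N) :
    homogeneousComponent N (p * q) = homogeneousComponent n p * q := by
  let := MvPolynomial.gradedAlgebra (σ := Fin 3) (R := ℂ)
  have := DirectSum.coe_decompose_mul_of_right_mem_of_le (homogeneousSubmodule (Fin 3) ℂ)
    (a := p) (n := N) (i := e) (b := q) hq (by omega)
  obtain rfl : N - e = n := by omega
  have key (r : S3) (i : ℕ) : ((DirectSum.decompose (homogeneousSubmodule (Fin 3) ℂ) r) i : S3) =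
      homogeneousComponent i r := decomposition.decompose'_apply r i
  rwa [key, key] at this

/-- A homogeneous combination of homogeneous elements may be taken with homogeneous
coefficients. -/
theorem sum_homogeneousComponent_mul {m : ℕ} (c M : Fin m → S3) (n e : Fin m → ℕ) (N : ℕ)
    (hM : ∀ j, (M j).IsHomogeneous (e j)) (hN : ∀ j, n j + e j = N)
    (h : (∑ j, c j * M j).IsHomogeneous N) :
    ∑ j, homogeneousComponent (n j) (c j) * M j = ∑ j, c j * M j := by
  rw [← homogeneousComponent_eq_self h, map_sum]
  exact Finset.sum_congr rfl fun j _ =>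
    (homogeneousComponent_mul_of_isHomogeneous (hM j) (hN j)).symm

/-- The tuples whose `j`-th entry is homogeneous of degree `n j`. -/
def gradedTuples {m : ℕ} (n : Fin m → ℕ) : Submodule ℂ (Fin m → S3) :=
  Submodule.pi Set.univ fun j => homogeneousSubmodule (Fin 3) ℂ (n j)

theorem mem_gradedTuples {m : ℕ} {n : Fin m → ℕ} {c : Fin m → S3} :
    c ∈ gradedTuples n ↔ ∀ j, (c j).IsHomogeneous (n j) := by
  simp [gradedTuples, Submodule.mem_pi]

/-- Graded tuples are a product of graded pieces. -/
def gradedTuplesEquiv {m : ℕ} (n : Fin m → ℕ) :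
    gradedTuples n ≃ₗ[ℂ] (∀ j, homogeneousSubmodule (Fin 3) ℂ (n j)) where
  toFun c j := ⟨c.1 j, mem_gradedTuples.1 c.2 j⟩
  invFun c := ⟨fun j => (c j).1, mem_gradedTuples.2 fun j => (c j).2⟩
  map_add' _ _ := rfl
  map_smul' _ _ := rfl
  left_inv _ := rfl
  right_inv _ := rfl

instance gradedTuples_finite {m : ℕ} (n : Fin m → ℕ) : Module.Finite ℂ (gradedTuples n) :=
  Module.Finite.equiv (gradedTuplesEquiv n).symm

theorem finrank_gradedTuples {m : ℕ} (n : Fin m → ℕ) :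
    Module.finrank ℂ (gradedTuples n) = ∑ j, (n j + 2).choose 2 := by
  rw [(gradedTuplesEquiv n).finrank_eq, Module.finrank_pi_fintype]
  simp [finrank_homogeneousSubmodule]

theorem finrank_comap_subtype {V : Type*} [AddCommGroup V] [Module ℂ V] (A B : Submodule ℂ V) :
    Module.finrank ℂ (B.comap A.subtype) = Module.finrank ℂ (A ⊓ B : Submodule ℂ V) := by
  rw [← (Submodule.comapSubtypeEquivOfLe (inf_le_left : A ⊓ B ≤ A)).finrank_eq,
    Submodule.comap_inf, Submodule.comap_subtype_self, top_inf_eq]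

theorem finrank_map_add_finrank_inf_ker {V W : Type*} [AddCommGroup V] [Module ℂ V]
    [AddCommGroup W] [Module ℂ W] (φ : V →ₗ[ℂ] W) (A : Submodule ℂ V) [Module.Finite ℂ A] :
    Module.finrank ℂ (A.map φ) + Module.finrank ℂ (A ⊓ LinearMap.ker φ : Submodule ℂ V) =
      Module.finrank ℂ A := by
  have h := LinearMap.finrank_range_add_finrank_ker (φ.domRestrict A)
  rwa [LinearMap.range_domRestrict, LinearMap.ker_domRestrict, finrank_comap_subtype] at h

/-- The map sending coefficients to the corresponding combination of partial derivatives. -/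
def jacMap (f : S3) : (Fin 3 → S3) →ₗ[ℂ] S3 :=
  (Fintype.linearCombination S3 fun i => pderiv i f).restrictScalars ℂ

theorem jacMap_apply (f : S3) (v : Fin 3 → S3) : jacMap f v = ∑ i, v i * pderiv i f := by
  simp [jacMap, Fintype.linearCombination_apply]

theorem mem_jacSyz {f : S3} {v : Fin 3 → S3} : v ∈ jacSyz f ↔ ∑ i, v i * pderiv i f = 0 := by
  rw [Fin.sum_univ_three]; rfl

theorem mem_jacobianIdeal {f p : S3} :
    p ∈ jacobianIdeal f ↔ ∃ v : Fin 3 → S3, ∑ i, v i * pderiv i f = p := by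
  have : ({pderiv 0 f, pderiv 1 f, pderiv 2 f} : Set S3) = Set.range fun i => pderiv i f := by
    ext; simp [Fin.exists_fin_succ, eq_comm]
  rw [jacobianIdeal, this, Ideal.mem_span_range_iff_exists_fun]

theorem milnorDim_add {f : S3} {e k : ℕ} (hf : f.IsHomogeneous (e + 1)) :
    milnorDim f (k + e) + 3 * (k + 2).choose 2 =
      (k + e + 2).choose 2 + Module.finrank ℂ (gradedTuples (fun _ : Fin 3 => k) ⊓
        (jacSyz f).restrictScalars ℂ : Submodule ℂ (Fin 3 → S3)) := by
  set H := homogeneousSubmodule (Fin 3) ℂ (k + e)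
  set J : Submodule ℂ S3 := (jacobianIdeal f).restrictScalars ℂ
  have hd : ∀ i, (pderiv i f).IsHomogeneous e := fun i => hf.pderiv
  have hmap : (gradedTuples (fun _ : Fin 3 => k)).map (jacMap f) = H ⊓ J := by
    ext p
    simp only [Submodule.mem_map, mem_gradedTuples, Submodule.mem_inf, jacMap_apply]
    constructor
    · rintro ⟨v, hv, rfl⟩
      exact ⟨IsHomogeneous.sum _ _ _ fun i _ => (hv i).mul (hd i), mem_jacobianIdeal.2 ⟨v, rfl⟩⟩
    · rintro ⟨hp, hJ⟩
      obtain ⟨v, rfl⟩ := mem_jacobianIdeal.1 hJ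
      exact ⟨fun i => homogeneousComponent k (v i), fun i => homogeneousComponent_isHomogeneous _ _,
        sum_homogeneousComponent_mul v _ (fun _ => k) (fun _ => e) _ hd (fun _ => rfl) hp⟩
  have hker : LinearMap.ker (jacMap f) = (jacSyz f).restrictScalars ℂ := by
    ext v
    simp [jacMap_apply, mem_jacSyz]
  have h1 := finrank_map_add_finrank_inf_ker (jacMap f) (gradedTuples (fun _ : Fin 3 => k))
  rw [hmap, hker, finrank_gradedTuples] at h1
  have h2 := Submodule.finrank_quotient_add_finrank (Submodule.comap H.subtype J)
  rw [finrank_comap_subtype] at h2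
  have h4 : Module.finrank ℂ H = _ := finrank_homogeneousSubmodule (k + e)
  simp only [Finset.sum_const, Finset.card_univ, Fintype.card_fin, smul_eq_mul] at h1
  have h1' : Module.finrank ℂ (H ⊓ J : Submodule ℂ S3) + _ = _ := h1
  have h2' : Module.finrank ℂ (H ⧸ J.comap H.subtype) +
      Module.finrank ℂ (H ⊓ J : Submodule ℂ S3) = _ := h2
  change Module.finrank ℂ (H ⧸ J.comap H.subtype) + _ = _
  linarith

/-- The combination map of a family of vectors. -/
def combMap {m : ℕ} (v : Fin m → Fin 3 → S3) : (Fin m → S3) →ₗ[ℂ] (Fin 3 → S3) :=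
  (Fintype.linearCombination S3 v).restrictScalars ℂ

theorem combMap_apply {m : ℕ} (v : Fin m → Fin 3 → S3) (c : Fin m → S3) :
    combMap v c = ∑ j, c j • v j := by
  simp [combMap, Fintype.linearCombination_apply]

theorem finrank_graded_jacSyz {f : S3} {m : ℕ} {v : Fin m → Fin 3 → S3} {dd n : Fin m → ℕ} {k : ℕ}
    (hom : ∀ j i, (v j i).IsHomogeneous (dd j)) (hspan : Submodule.span S3 (Set.range v) = jacSyz f)
    (hk : ∀ j, n j + dd j = k) :
    Module.finrank ℂ (gradedTuples (fun _ : Fin 3 => k) ⊓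
        (jacSyz f).restrictScalars ℂ : Submodule ℂ (Fin 3 → S3)) +
      Module.finrank ℂ (gradedTuples n ⊓ LinearMap.ker (combMap v) : Submodule ℂ (Fin m → S3)) =
      ∑ j, (n j + 2).choose 2 := by
  have hmap : (gradedTuples n).map (combMap v) =
      gradedTuples (fun _ : Fin 3 => k) ⊓ (jacSyz f).restrictScalars ℂ := by
    ext w
    simp only [Submodule.mem_map, Submodule.mem_inf, mem_gradedTuples, combMap_apply,
      Submodule.restrictScalars_mem]
    rw [← hspan, Submodule.mem_span_range_iff_exists_fun]
    constructor
    · rintro ⟨c, hc, rfl⟩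
      refine ⟨fun i => ?_, c, rfl⟩
      simp only [Finset.sum_apply, Pi.smul_apply, smul_eq_mul]
      exact IsHomogeneous.sum _ _ _ fun j _ => hk j ▸ (hc j).mul (hom j i)
    · rintro ⟨hw, c, rfl⟩
      refine ⟨fun j => homogeneousComponent (n j) (c j),
        fun j => homogeneousComponent_isHomogeneous _ _, ?_⟩
      ext1 i
      have := hw i
      simp only [Finset.sum_apply, Pi.smul_apply, smul_eq_mul] at this ⊢
      exact sum_homogeneousComponent_mul c (fun j => v j i) n dd k (fun j => hom j i) hk this
  rw [← hmap, finrank_map_add_finrank_inf_ker, finrank_gradedTuples]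

theorem cast_choose_add_two (n : ℕ) : (2 * (n + 2).choose 2 : ℤ) = (n + 1) * (n + 2) := by
  have h2 : 2 * (n + 2).choose 2 = (n + 1) * (n + 2) := by
    rw [Nat.choose_two_right, Nat.mul_div_cancel' (Nat.even_mul_pred_self _).two_dvd]
    simp [mul_comm]
  exact_mod_cast h2

/-- The Tjurina number of a free curve. -/
theorem isTjurina_of_free {f : S3} {d₁ d₂ τ : ℕ} {v : Fin 2 → Fin 3 → S3}
    (hf : f.IsHomogeneous (d₁ + d₂ + 1)) (hv : IsMinGenSyz f 2 ![d₁, d₂] v)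
    (hind : ∀ c : Fin 2 → S3, ∑ j, c j • v j = 0 → c = 0)
    (hτ : τ + d₁ * d₂ = (d₁ + d₂) ^ 2) : IsTjurina f τ := by
  refine Filter.eventually_atTop.2 ⟨2 * (d₁ + d₂), fun k' hk' => ?_⟩
  obtain ⟨l, rfl⟩ := Nat.exists_eq_add_of_le' hk'
  have h1 := milnorDim_add (k := l + (d₁ + d₂)) hf
  have h2 := finrank_graded_jacSyz (n := ![l + d₂, l + d₁]) (k := l + (d₁ + d₂)) hv.hom hv.span_eq
    (by intro j; fin_cases j <;> simp <;> omega)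
  have hk : gradedTuples ![l + d₂, l + d₁] ⊓ LinearMap.ker (combMap v) = ⊥ := by
    rw [eq_bot_iff]
    rintro c ⟨-, hc⟩
    exact hind c (by simpa [combMap_apply] using hc)
  rw [hk, finrank_bot, Fin.sum_univ_two] at h2
  simp only [Matrix.cons_val_zero, Matrix.cons_val_one, add_zero] at h2
  rw [h2, add_assoc l, ← two_mul (d₁ + d₂)] at h1
  have e1 := cast_choose_add_two (l + (d₁ + d₂))
  have e2 := cast_choose_add_two (l + 2 * (d₁ + d₂))
  have e3 := cast_choose_add_two (l + d₁)
  have e4 := cast_choose_add_two (l + d₂)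
  zify at h1 hτ ⊢
  push_cast at e1 e2 e3 e4
  have : (2 : ℤ) * milnorDim f (l + 2 * (d₁ + d₂)) = 2 * τ := by
    linear_combination 2 * h1 - 3 * e1 + e2 + e3 + e4 - 2 * hτ
  linarith

/-- The Tjurina number of a plus-one generated curve. -/
theorem isTjurina_of_relation {f : S3} {d₁ d₂ d₃ r₁ r₂ τ : ℕ} {v : Fin 3 → Fin 3 → S3}
    {p : Fin 3 → S3} (hf : f.IsHomogeneous (d₁ + d₂)) (hv : IsMinGenSyz f 3 ![d₁, d₂, d₃] v)
    (hp : ∀ j, (p j).IsHomogeneous (![r₁, r₂, 1] j)) (hp0 : p 2 ≠ 0)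
    (h₁ : d₁ + r₁ = d₃ + 1) (h₂ : d₂ + r₂ = d₃ + 1)
    (hrel : ∑ j, p j • v j = 0)
    (hker : ∀ c : Fin 3 → S3, ∑ j, c j • v j = 0 → ∃ h : S3, c = h • p)
    (hpos : 0 < d₁ + d₂)
    (hτ : (τ : ℤ) = (d₁ + d₂ - 1) ^ 2 - d₁ * (d₂ - 1) - (d₃ + 1 - d₂)) : IsTjurina f τ := by
  obtain ⟨e, he⟩ : ∃ e, d₁ + d₂ = e + 1 := ⟨d₁ + d₂ - 1, by omega⟩
  rw [he] at hf
  refine Filter.eventually_atTop.2 ⟨d₃ + 1 + e, fun k' hk' => ?_⟩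
  obtain ⟨l, rfl⟩ := Nat.exists_eq_add_of_le' hk'
  have h1 := milnorDim_add (k := l + (d₃ + 1)) hf
  have h2 := finrank_graded_jacSyz (n := ![l + r₁, l + r₂, l + 1]) (k := l + (d₃ + 1))
    hv.hom hv.span_eq (by intro j; fin_cases j <;> simp <;> omega)
  set μ : S3 →ₗ[ℂ] (Fin 3 → S3) := (LinearMap.toSpanSingleton S3 _ p).restrictScalars ℂ with hμ
  have hμa : ∀ h, μ h = h • p := fun h => rfl
  have hinj : Function.Injective μ := fun a b hab => by
    have := congrFun hab 2
    simpa [hμa, hp0] using this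
  have hk : gradedTuples ![l + r₁, l + r₂, l + 1] ⊓ LinearMap.ker (combMap v) =
      (homogeneousSubmodule (Fin 3) ℂ l).map μ := by
    ext c
    simp only [Submodule.mem_inf, mem_gradedTuples, LinearMap.mem_ker, combMap_apply,
      Submodule.mem_map, mem_homogeneousSubmodule, hμa]
    have hdeg : ∀ j, ![l + r₁, l + r₂, l + 1] j = l + ![r₁, r₂, 1] j := by
      intro j; fin_cases j <;> rfl
    constructor
    · rintro ⟨hc, hc0⟩
      obtain ⟨h, rfl⟩ := hker c hc0
      refine ⟨homogeneousComponent l h, homogeneousComponent_isHomogeneous _ _, ?_⟩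
      ext1 j
      have := homogeneousComponent_eq_self (hc j)
      rw [Pi.smul_apply, smul_eq_mul, ← this, Pi.smul_apply, smul_eq_mul]
      exact (homogeneousComponent_mul_of_isHomogeneous (hp j) (hdeg j).symm).symm
    · rintro ⟨h, hh, rfl⟩
      refine ⟨fun j => hdeg j ▸ hh.mul (hp j), ?_⟩
      simp only [Pi.smul_apply, smul_assoc, ← Finset.smul_sum, hrel, smul_zero]
  rw [hk, ← (Submodule.equivMapOfInjective μ hinj _).finrank_eq, finrank_homogeneousSubmodule,
    Fin.sum_univ_three] at h2
  simp only [Matrix.cons_val_zero, Matrix.cons_val_one, Matrix.cons_val] at h2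
  rw [add_assoc l] at h1
  have e1 := cast_choose_add_two (l + (d₃ + 1))
  have e2 := cast_choose_add_two (l + (d₃ + 1 + e))
  have e3 := cast_choose_add_two (l + r₁)
  have e4 := cast_choose_add_two (l + r₂)
  have e5 := cast_choose_add_two (l + 1)
  have e6 := cast_choose_add_two l
  zify at h1 h2 h₁ h₂ he ⊢
  push_cast at e1 e2 e3 e4 e5 e6
  have hr₁ : (r₁ : ℤ) = d₃ + 1 - d₁ := by linarith
  have hr₂ : (r₂ : ℤ) = d₃ + 1 - d₂ := by linarith
  have he' : (e : ℤ) = d₁ + d₂ - 1 := by linarith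
  rw [hr₁] at e3
  rw [hr₂] at e4
  rw [he'] at e2
  have : (2 : ℤ) * milnorDim f (l + (d₃ + 1 + e)) = 2 * τ := by
    linear_combination 2 * h1 + 2 * h2 - 3 * e1 + e2 + e3 + e4 + e5 - e6 - 2 * hτ
  linarith

/-! ### Vectors orthogonal to a saturated vector -/

section Saturated

open Matrix

variable {R : Type*} [CommRing R]

/-- Every vector parallel to `g` is a multiple of `g`. -/
def IsSaturatedVec (g : Fin 3 → R) : Prop :=
  g 0 ≠ 0 ∧ ∀ w : Fin 3 → R, w ⨯₃ g = 0 → ∃ h : R, w = h • g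

theorem IsSaturatedVec.cross {g u v : Fin 3 → R} (hg : IsSaturatedVec g) (hu : u ⬝ᵥ g = 0)
    (hv : v ⬝ᵥ g = 0) : ∃ h : R, u ⨯₃ v = h • g :=
  hg.2 _ (by rw [cross_cross_eq_smul_sub_smul, hu, hv, zero_smul, zero_smul, sub_zero])

/-- The pair `(p, q)` is a regular sequence modulo `L`, in first syzygy form. -/
def IsKoszulPair (L p q : R) : Prop :=
  ∀ a b : R, L ∣ a * q - b * p → ∃ h : R, L ∣ a - h * p ∧ L ∣ b - h * q

theorem isKoszulPair_mul {L p z m : R} (hL : Prime L) (hLz : ¬ L ∣ z) (hLm : ¬ L ∣ m)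
    (hz : (Ideal.span {L, z}).IsPrime) (hm : (Ideal.span {L, m}).IsPrime)
    (hpz : p ∉ Ideal.span {L, z}) (hpm : p ∉ Ideal.span {L, m}) :
    IsKoszulPair L p (z * m) := by
  rintro a b ⟨r, hr⟩
  have hb : b ∈ Ideal.span {L, z} := by
    refine (hz.mem_or_mem (Ideal.mem_span_pair.2 ⟨-r, a * m, ?_⟩)).resolve_right hpz
    linear_combination hr
  obtain ⟨b₁, b₂, rfl⟩ := Ideal.mem_span_pair.1 hb
  obtain ⟨r', hr'⟩ : L ∣ a * m - b₂ * p := by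
    refine (hL.dvd_or_dvd (⟨r + b₁ * p, ?_⟩ : L ∣ z * (a * m - b₂ * p))).resolve_left hLz
    linear_combination hr
  have hb₂ : b₂ ∈ Ideal.span {L, m} := by
    refine (hm.mem_or_mem (Ideal.mem_span_pair.2 ⟨-r', a, ?_⟩)).resolve_right hpm
    linear_combination hr'
  obtain ⟨b₃, h, rfl⟩ := Ideal.mem_span_pair.1 hb₂
  refine ⟨h, (hL.dvd_or_dvd (⟨r' + b₃ * p, ?_⟩ : L ∣ m * (a - h * p))).resolve_left hLm,
    b₁ + b₃ * z, by ring⟩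
  linear_combination hr'

variable [IsDomain R]

theorem isSaturatedVec_of_pow {g v : Fin 3 → R} {z : R} {N : ℕ} (hz : Prime z)
    (hg : ¬ z ∣ g 0) (hv : v ⬝ᵥ g = z ^ N) : IsSaturatedVec g := by
  refine ⟨fun h => hg (h ▸ dvd_zero z), fun w hw => ?_⟩
  have h0 := congrFun hw 0
  have h1 := congrFun hw 1
  have h2 := congrFun hw 2
  simp only [cross_apply, cons_val, Pi.zero_apply] at h0 h1 h2
  simp only [vec3_dotProduct] at hv
  have key : ∀ i, z ^ N * w i = (v ⬝ᵥ w) * g i := by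
    intro i
    rw [← hv, vec3_dotProduct]
    fin_cases i <;> simp only [Fin.zero_eta, Fin.mk_one, Fin.reduceFinMk]
    · linear_combination v 1 * h2 - v 2 * h1
    · linear_combination v 2 * h0 - v 0 * h2
    · linear_combination v 0 * h1 - v 1 * h0
  obtain ⟨h, hh⟩ : z ^ N ∣ v ⬝ᵥ w :=
    hz.pow_dvd_of_dvd_mul_right N hg ⟨w 0, (key 0).symm⟩
  refine ⟨h, funext fun i => mul_left_cancel₀ (pow_ne_zero N hz.ne_zero) ?_⟩
  rw [key, hh, Pi.smul_apply, smul_eq_mul, mul_assoc]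

theorem dotProduct_eq_zero_of_cross {g u v : Fin 3 → R} {L : R} (hL : L ≠ 0)
    (h : u ⨯₃ v = L • g) : u ⬝ᵥ g = 0 ∧ v ⬝ᵥ g = 0 := by
  constructor <;> refine (mul_eq_zero.1 ?_).resolve_left hL <;>
    rw [← smul_eq_mul, ← dotProduct_smul, ← h]
  exacts [dot_self_cross u v, dot_cross_self u v]

theorem IsSaturatedVec.exists_smul_eq {g u v w : Fin 3 → R} {L : R} (hg : IsSaturatedVec g)
    (hL : L ≠ 0) (h : u ⨯₃ v = L • g) (hw : w ⬝ᵥ g = 0) :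
    ∃ a b : R, L • w = a • u + b • v := by
  obtain ⟨hu, hv⟩ := dotProduct_eq_zero_of_cross hL h
  obtain ⟨a, ha⟩ := hg.cross hw hv
  obtain ⟨b, hb⟩ := hg.cross hu hw
  refine ⟨a, b, funext fun i => mul_left_cancel₀ hg.1 ?_⟩
  have h0 := congrFun h 0
  have h1 := congrFun h 1
  have h2 := congrFun h 2
  have ha0 := congrFun ha 0
  have hb0 := congrFun hb 0
  simp only [cross_apply, cons_val, Pi.smul_apply, smul_eq_mul] at h0 h1 h2 ha0 hb0
  simp only [vec3_dotProduct] at hw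
  fin_cases i <;>
    simp only [Fin.zero_eta, Fin.mk_one, Fin.reduceFinMk, Pi.add_apply, Pi.smul_apply, smul_eq_mul]
  · linear_combination u 0 * ha0 + v 0 * hb0 + L * hw + w 1 * h1 + w 2 * h2
  · linear_combination u 1 * ha0 + v 1 * hb0 - w 1 * h0
  · linear_combination u 2 * ha0 + v 2 * hb0 - w 2 * h0

theorem eq_zero_of_smul_add_smul {g u v : Fin 3 → R} {L a b : R} (hg : g 0 ≠ 0)
    (hL : L ≠ 0) (h : u ⨯₃ v = L • g) (hab : a • u + b • v = 0) : a = 0 ∧ b = 0 := by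
  have h0 := congrFun h 0
  have h1 := congrFun hab 1
  have h2 := congrFun hab 2
  simp only [cross_apply, cons_val, Pi.add_apply, Pi.smul_apply, smul_eq_mul,
    Pi.zero_apply] at h0 h1 h2
  have hLg := mul_ne_zero hL hg
  constructor <;> refine (mul_eq_zero.1 ?_).resolve_right hLg
  · linear_combination (-a) * h0 + v 2 * h1 - v 1 * h2
  · linear_combination (-b) * h0 + u 1 * h2 - u 2 * h1

theorem IsSaturatedVec.exists_three {g u v t w : Fin 3 → R} {L p q : R} (hg : IsSaturatedVec g)
    (hL : L ≠ 0) (h : u ⨯₃ v = L • g) (ht : L • t = p • u + q • v) (hK : IsKoszulPair L p q)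
    (hw : w ⬝ᵥ g = 0) : ∃ a b c : R, w = a • u + b • v + c • t := by
  obtain ⟨hu, hv⟩ := dotProduct_eq_zero_of_cross hL h
  have htg : t ⬝ᵥ g = 0 := by
    refine (mul_eq_zero.1 ?_).resolve_left hL
    rw [← smul_eq_mul, ← smul_dotProduct, ht, add_dotProduct, smul_dotProduct, smul_dotProduct,
      hu, hv, smul_zero, smul_zero, add_zero]
  obtain ⟨a, b, hab⟩ := hg.exists_smul_eq hL h hw
  obtain ⟨c, hc⟩ := hg.cross hw htg
  have hdvd : L ∣ a * q - b * p := by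
    refine ⟨c, mul_left_cancel₀ (mul_ne_zero hL hg.1) ?_⟩
    have e0 := congrFun h 0
    have e1 := congrFun ht 1
    have e2 := congrFun ht 2
    have e3 := congrFun hab 1
    have e4 := congrFun hab 2
    have e5 := congrFun hc 0
    simp only [cross_apply, cons_val, Pi.add_apply, Pi.smul_apply, smul_eq_mul] at e0 e1 e2 e3 e4 e5
    linear_combination (-(a * q - b * p)) * e0 - (L * t 2) * e3 - (a * u 1 + b * v 1) * e2
      + (L * t 1) * e4 + (a * u 2 + b * v 2) * e1 + L ^ 2 * e5
  obtain ⟨s, ⟨a', ha⟩, b', hb⟩ := hK a b hdvd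
  refine ⟨a', b', s, funext fun i => mul_left_cancel₀ hL ?_⟩
  have e1 := congrFun ht i
  have e2 := congrFun hab i
  simp only [Pi.add_apply, Pi.smul_apply, smul_eq_mul] at e1 e2 ⊢
  linear_combination e2 - s * e1 + u i * ha + v i * hb

theorem exists_eq_mul_of_three {g u v t : Fin 3 → R} {L p q a b c : R} (hg : g 0 ≠ 0)
    (hL : Prime L) (hp : ¬ L ∣ p) (h : u ⨯₃ v = L • g) (ht : L • t = p • u + q • v)
    (habc : a • u + b • v + c • t = 0) : ∃ s : R, a = s * p ∧ b = s * q ∧ c = s * -L := by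
  have key : (L * a + c * p) • u + (L * b + c * q) • v = 0 := by
    funext i
    have e1 := congrFun ht i
    have e2 := congrFun habc i
    simp only [Pi.add_apply, Pi.smul_apply, smul_eq_mul, Pi.zero_apply] at e1 e2 ⊢
    linear_combination L * e2 - c * e1
  obtain ⟨ha, hb⟩ := eq_zero_of_smul_add_smul hg hL.ne_zero h key
  obtain ⟨s, rfl⟩ : L ∣ c :=
    (hL.dvd_or_dvd (⟨-a, by linear_combination ha⟩ : L ∣ c * p)).resolve_right hp
  refine ⟨-s, mul_left_cancel₀ hL.ne_zero ?_, mul_left_cancel₀ hL.ne_zero ?_, by ring⟩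
  · linear_combination ha
  · linear_combination hb

end Saturated

/-! ### Linear forms -/

section LinearForms

open Matrix

/-- The linear form with coefficient vector `u`. -/
def linForm (u : Fin 3 → ℂ) : S3 := ∑ i, C (u i) * X i

theorem eval_linForm (u a : Fin 3 → ℂ) : eval a (linForm u) = u ⬝ᵥ a := by
  simp [linForm, dotProduct]

theorem isPrime_of_retraction {I : Ideal S3} (φ : S3 →ₐ[ℂ] S3) (hI : ∀ p ∈ I, φ p = 0)
    (hX : ∀ i, X i - φ (X i) ∈ I) : I.IsPrime := by
  have hmk : (Ideal.Quotient.mkₐ ℂ I).comp φ = Ideal.Quotient.mkₐ ℂ I := by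
    ext i
    exact ((Ideal.Quotient.mk_eq_mk_iff_sub_mem _ _).2 (hX i)).symm
  have hker : I = RingHom.ker φ := by
    refine le_antisymm (fun p hp => hI p hp) fun p hp => ?_
    rw [← Ideal.Quotient.eq_zero_iff_mem, ← Ideal.Quotient.mkₐ_eq_mk ℂ, ← hmk,
      AlgHom.comp_apply, show φ p = 0 from hp, map_zero]
  rw [hker]
  exact RingHom.ker_isPrime _

theorem prime_linForm {u : Fin 3 → ℂ} (hu : u 0 ≠ 0) : Prime (linForm u) := by
  have h0 : linForm u ≠ 0 := fun h => hu <| by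
    simpa [linForm, Fin.sum_univ_three] using congrArg (eval ![1, 0, 0]) h
  rw [← Ideal.span_singleton_prime h0]
  have hC : C (u 0)⁻¹ * C (u 0) = (1 : S3) := by rw [← C_mul, inv_mul_cancel₀ hu, C_1]
  refine isPrime_of_retraction (aeval fun i => X i - if i = 0 then C (u 0)⁻¹ * linForm u else 0)
    (fun p hp => ?_) fun i => ?_
  · obtain ⟨r, rfl⟩ := Ideal.mem_span_singleton.1 hp
    have : (aeval fun i => X i - if i = 0 then C (u 0)⁻¹ * linForm u else (0 : S3))
        (linForm u) = 0 := by
      conv_lhs => rw [linForm]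
      simp only [Fin.sum_univ_three]
      simp
      linear_combination (-(C (u 0) * X 0 + C (u 1) * X 1 + C (u 2) * X 2)) * hC
    rw [map_mul, this, zero_mul]
  · rw [aeval_X, sub_sub_cancel]
    split_ifs
    · exact Ideal.mul_mem_left _ _ (Ideal.mem_span_singleton_self _)
    · exact zero_mem _

theorem isPrime_span_linForm {u v : Fin 3 → ℂ} (h : (u ⨯₃ v) 0 ≠ 0) :
    (Ideal.span {linForm u, linForm v}).IsPrime := by
  set a := u ⨯₃ v with ha
  refine isPrime_of_retraction (aeval fun i => C (a i / a 0) * X 0) (fun p hp => ?_) fun i => ?_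
  · have key (w : Fin 3 → ℂ) (hw : w ⬝ᵥ a = 0) :
        (aeval fun i => C (a i / a 0) * X 0 : S3 →ₐ[ℂ] S3) (linForm w) = 0 := by
      have : ∑ i, w i * (a i / a 0) = 0 := by
        simp_rw [← mul_div_assoc, ← Finset.sum_div]
        rw [show ∑ i, w i * a i = 0 from hw, zero_div]
      simp only [linForm, map_sum, map_mul, aeval_X, algHom_C, algebraMap_eq]
      simp_rw [← mul_assoc, ← C_mul, ← Finset.sum_mul]
      rw [← map_sum, this, C_0, zero_mul]
    obtain ⟨r, s, rfl⟩ := Ideal.mem_span_pair.1 hp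
    rw [map_add, map_mul, map_mul, key u (dot_self_cross u v), key v (dot_cross_self u v),
      mul_zero, mul_zero, add_zero]
  · have hk : X i - C (a i / a 0) * X 0 = C (a 0)⁻¹ * (C (a 0) * X i - C (a i) * X 0 : S3) := by
      rw [mul_sub, ← mul_assoc, ← mul_assoc, ← C_mul, ← C_mul, inv_mul_cancel₀ h, C_1, one_mul,
        div_eq_inv_mul]
    rw [aeval_X, hk]
    have h0 := congrFun ha 0
    have h1 := congrFun ha 1
    have h2 := congrFun ha 2
    simp only [cross_apply, cons_val] at h0 h1 h2
    refine Ideal.mul_mem_left _ _ (Ideal.mem_span_pair.2 ?_)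
    simp only [linForm, Fin.sum_univ_three]
    fin_cases i <;> simp only [Fin.zero_eta, Fin.mk_one, Fin.reduceFinMk, h0, h1, h2, C_sub, C_mul]
    · exact ⟨0, 0, by ring⟩
    · exact ⟨C (v 2), -C (u 2), by ring⟩
    · exact ⟨-C (v 1), C (u 1), by ring⟩

theorem not_mem_span_linForm {u v : Fin 3 → ℂ} {p : S3} (h : eval (u ⨯₃ v) p ≠ 0) :
    p ∉ Ideal.span {linForm u, linForm v} := fun hp => h <| by
  obtain ⟨r, s, rfl⟩ := Ideal.mem_span_pair.1 hp
  rw [map_add, map_mul, map_mul, eval_linForm, eval_linForm, dot_self_cross, dot_cross_self,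
    mul_zero, mul_zero, add_zero]

end LinearForms

/-! ### Minimal generators from relations -/

theorem IsMinGenSyz.of_relations {f : S3} {m : ℕ} {dd : Fin m → ℕ} {v : Fin m → Fin 3 → S3}
    (mem : ∀ j, v j ∈ jacSyz f) (hom : ∀ j i, (v j i).IsHomogeneous (dd j)) (mono : Monotone dd)
    (gen : ∀ w ∈ jacSyz f, ∃ c : Fin m → S3, w = ∑ j, c j • v j)
    (rel : ∀ c : Fin m → S3, ∑ j, c j • v j = 0 → ∀ j, constantCoeff (c j) = 0) :
    IsMinGenSyz f m dd v := by
  have minimal : ∀ j, v j ∉ Submodule.span S3 (v '' {j' | j' ≠ j}) := by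
    intro j hj
    obtain ⟨l, hl, hlv⟩ := (Finsupp.mem_span_image_iff_linearCombination S3).1 hj
    have hlj : l j = 0 := (Finsupp.mem_supported' S3 l).1 hl j (by simp)
    have := rel (l - Finsupp.single j 1 : Fin m →₀ S3) (by
      rw [← Finsupp.sum_fintype (l - Finsupp.single j 1) (fun j c => c • v j) (by simp),
        ← Finsupp.linearCombination_apply S3, map_sub, hlv, Finsupp.linearCombination_single,
        one_smul, sub_self]) j
    simp [hlj] at this
  refine ⟨mem, hom, fun j hj => minimal j (hj ▸ zero_mem _), ?_, minimal, mono⟩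
  refine le_antisymm (Submodule.span_le.2 (Set.range_subset_iff.2 mem)) fun w hw => ?_
  obtain ⟨c, rfl⟩ := gen w hw
  exact Submodule.sum_smul_mem _ _ fun j _ => Submodule.subset_span ⟨j, rfl⟩

/-! ### Adding the line at infinity -/

theorem prime_X_two : Prime (X 2 : S3) := X_prime

theorem X_mul_jacSyz {f : S3} {v : Fin 3 → S3} : v ∈ jacSyz (X 2 * f) ↔
    X 2 * ∑ i, v i * pderiv i f + v 2 * f = 0 := by
  rw [mem_jacSyz]
  simp only [Derivation.leibniz, smul_eq_mul, pderiv_X, Fin.sum_univ_three]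
  simp
  constructor <;> intro h <;> linear_combination h

/-- The syzygy of `X 2 * f`, with `f` of degree `d`, attached to a syzygy `w` of `f` with last
entry `X 2 * q`. -/
def addLine (d : ℕ) (w : Fin 3 → S3) (q : S3) : Fin 3 → S3 :=
  fun i => w i - C ((d + 1 : ℂ)⁻¹) * q * X i

theorem isHomogeneous_addLine {d n : ℕ} {w : Fin 3 → S3} {q : S3}
    (hw : ∀ i, (w i).IsHomogeneous (n + 1)) (hq : q.IsHomogeneous n) (i : Fin 3) :
    (addLine d w q i).IsHomogeneous (n + 1) :=
  (hw i).sub (by simpa using ((isHomogeneous_C _ _).mul hq).mul (isHomogeneous_X ℂ i))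

theorem C_add_one_mul (d : ℕ) : (C ((d + 1 : ℂ)⁻¹) : S3) * ((d : S3) + 1) = 1 := by
  have : ((d : S3) + 1) = C (d + 1 : ℂ) := by simp
  rw [this, ← C_mul, inv_mul_cancel₀ (Nat.cast_add_one_ne_zero d), C_1]

section AddLine

variable {f : S3} {d m : ℕ} {w : Fin m → Fin 3 → S3} {q : Fin m → S3}

theorem addLine_mem (hf : f.IsHomogeneous d) {w : Fin 3 → S3} {q : S3} (hw : w ∈ jacSyz f)
    (hq : w 2 = X 2 * q) : addLine d w q ∈ jacSyz (X 2 * f) := by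
  rw [X_mul_jacSyz]
  rw [mem_jacSyz] at hw
  have hE := hf.sum_X_mul_pderiv
  have hC := C_add_one_mul d
  simp only [addLine, hq, Fin.sum_univ_three, nsmul_eq_mul] at hE hw ⊢
  linear_combination (-f * X 2 * q) * hC + X 2 * hw - (X 2 * C ((d + 1 : ℂ)⁻¹) * q) * hE

theorem sum_addLine (c : Fin m → S3) :
    ∑ j, c j • addLine d (w j) (q j) =
      ∑ j, c j • w j - fun i => C ((d + 1 : ℂ)⁻¹) * (∑ j, c j * q j) * X i := by
  funext i
  simp only [Finset.sum_apply, Pi.smul_apply, addLine, smul_eq_mul, Pi.sub_apply, mul_sub,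
    Finset.sum_sub_distrib, Finset.mul_sum, Finset.sum_mul]
  congr 1
  exact Finset.sum_congr rfl fun j _ => by ring

theorem exists_eq_sum_addLine (hf : f.IsHomogeneous d) (hd : d ≠ 0) (hzf : ¬ X 2 ∣ f)
    (hq : ∀ j, w j 2 = X 2 * q j)
    (gen : ∀ v ∈ jacSyz f, X 2 ∣ v 2 → ∃ c : Fin m → S3, v = ∑ j, c j • w j)
    {v : Fin 3 → S3} (hv : v ∈ jacSyz (X 2 * f)) :
    ∃ c : Fin m → S3, v = ∑ j, c j • addLine d (w j) (q j) := by
  rw [X_mul_jacSyz] at hv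
  obtain ⟨r, hr⟩ : X 2 ∣ v 2 :=
    (prime_X_two.dvd_or_dvd (⟨-∑ i, v i * pderiv i f, by linear_combination hv⟩ :
      X 2 ∣ v 2 * f)).resolve_right hzf
  have hD : (C ((d : ℂ)⁻¹) : S3) * d = 1 := by
    have : (d : S3) = C (d : ℂ) := by simp
    rw [this, ← C_mul, inv_mul_cancel₀ (Nat.cast_ne_zero.2 hd), C_1]
  have hC := C_add_one_mul d
  have hE := hf.sum_X_mul_pderiv
  have hv' : ∑ i, v i * pderiv i f = -r * f := by
    refine mul_left_cancel₀ prime_X_two.ne_zero ?_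
    rw [hr] at hv
    linear_combination hv
  obtain ⟨c, hc⟩ := gen (fun i => v i + C ((d : ℂ)⁻¹) * r * X i) (by
    rw [mem_jacSyz]
    simp only [Fin.sum_univ_three, nsmul_eq_mul] at hE hv' ⊢
    linear_combination hv' + C ((d : ℂ)⁻¹) * r * hE + r * f * hD) (by
    simp only [hr]
    exact ⟨r + C ((d : ℂ)⁻¹) * r, by ring⟩)
  refine ⟨c, ?_⟩
  have hsum : ∑ j, c j * q j = r * (1 + C ((d : ℂ)⁻¹)) := by
    refine mul_left_cancel₀ prime_X_two.ne_zero ?_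
    have := congrFun hc 2
    simp only [Finset.sum_apply, Pi.smul_apply, hq, smul_eq_mul, hr] at this
    rw [Finset.mul_sum]
    simp_rw [mul_left_comm (X 2 : S3)]
    linear_combination -this
  rw [sum_addLine, ← hc, hsum]
  funext i
  simp only [Pi.sub_apply]
  linear_combination (r * X i * C ((d : ℂ)⁻¹)) * hC - (r * X i * C ((d + 1 : ℂ)⁻¹)) * hD

theorem sum_smul_eq_zero_of_addLine (hf : f.IsHomogeneous d) (hd : d ≠ 0) (hzf : ¬ X 2 ∣ f)
    (hw : ∀ j, w j ∈ jacSyz f) {c : Fin m → S3}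
    (hc : ∑ j, c j • addLine d (w j) (q j) = 0) : ∑ j, c j • w j = 0 := by
  rw [sum_addLine, sub_eq_zero] at hc
  have hmem : ∑ j, c j • w j ∈ jacSyz f := Submodule.sum_smul_mem _ _ fun j _ => hw j
  rw [hc, mem_jacSyz] at hmem
  have hE := hf.sum_X_mul_pderiv
  have h0 : C ((d + 1 : ℂ)⁻¹) * (∑ j, c j * q j) * ((d : S3) * f) = 0 := by
    rw [← nsmul_eq_mul, ← hE, ← hmem, Finset.mul_sum]
    exact Finset.sum_congr rfl fun i _ => by ring
  have hf0 : (d : S3) * f ≠ 0 :=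
    mul_ne_zero (Nat.cast_ne_zero.2 hd) fun h => hzf (h ▸ dvd_zero _)
  rw [hc, (mul_eq_zero.1 h0).resolve_right hf0]
  funext i
  simp

end AddLine

/-! ### Criteria for free and plus-one generated curves -/

section Criteria

open Matrix

/-- The gradient of `f`. -/
def grad (f : S3) : Fin 3 → S3 := fun i => pderiv i f

theorem mem_jacSyz_iff_dotProduct {f : S3} {v : Fin 3 → S3} : v ∈ jacSyz f ↔ v ⬝ᵥ grad f = 0 :=
  mem_jacSyz

theorem constantCoeff_eq_zero_of_isHomogeneous {p : S3} {n : ℕ} (hp : p.IsHomogeneous n)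
    (hn : n ≠ 0) : constantCoeff p = 0 := by
  rw [constantCoeff_eq]
  exact hp.coeff_eq_zero (by simpa using hn.symm)

theorem isFreeWith_of_basis {f : S3} {d₁ d₂ τ : ℕ} {v : Fin 2 → Fin 3 → S3}
    (hf : f.IsHomogeneous (d₁ + d₂ + 1)) (hd : d₁ ≤ d₂)
    (mem : ∀ j, v j ∈ jacSyz f) (hom : ∀ j i, (v j i).IsHomogeneous (![d₁, d₂] j))
    (gen : ∀ w ∈ jacSyz f, ∃ c : Fin 2 → S3, w = ∑ j, c j • v j)
    (ind : ∀ c : Fin 2 → S3, ∑ j, c j • v j = 0 → c = 0)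
    (hτ : τ + d₁ * d₂ = (d₁ + d₂) ^ 2) : IsFreeWith f d₁ d₂ ∧ IsTjurina f τ := by
  have h : IsMinGenSyz f 2 ![d₁, d₂] v := by
    refine .of_relations mem hom ?_ gen fun c hc j => by simp [ind c hc]
    simpa [Fin.monotone_iff_le_succ] using hd
  exact ⟨⟨v, h⟩, isTjurina_of_free hf h ind hτ⟩

theorem isMinGenSyz_of_relation {f : S3} {d₁ d₂ d₃ r₁ r₂ τ : ℕ} {v : Fin 3 → Fin 3 → S3}
    {p : Fin 3 → S3} (hf : f.IsHomogeneous (d₁ + d₂)) (h₁₂ : d₁ ≤ d₂) (h₂₃ : d₂ ≤ d₃)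
    (hd₁ : 0 < d₁)
    (mem : ∀ j, v j ∈ jacSyz f) (hom : ∀ j i, (v j i).IsHomogeneous (![d₁, d₂, d₃] j))
    (gen : ∀ w ∈ jacSyz f, ∃ c : Fin 3 → S3, w = ∑ j, c j • v j)
    (hp : ∀ j, (p j).IsHomogeneous (![r₁, r₂, 1] j)) (hp0 : p 2 ≠ 0)
    (h₁ : d₁ + r₁ = d₃ + 1) (h₂ : d₂ + r₂ = d₃ + 1)
    (hrel : ∑ j, p j • v j = 0)
    (hker : ∀ c : Fin 3 → S3, ∑ j, c j • v j = 0 → ∃ h : S3, c = h • p)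
    (hτ : (τ : ℤ) = (d₁ + d₂ - 1) ^ 2 - d₁ * (d₂ - 1) - (d₃ + 1 - d₂)) :
    IsMinGenSyz f 3 ![d₁, d₂, d₃] v ∧ IsTjurina f τ := by
  have h : IsMinGenSyz f 3 ![d₁, d₂, d₃] v := by
    refine .of_relations mem hom ?_ gen fun c hc j => ?_
    · simp [Fin.monotone_iff_le_succ, Fin.forall_fin_two, h₁₂, h₂₃]
    · obtain ⟨h, rfl⟩ := hker c hc
      rw [Pi.smul_apply, smul_eq_mul, map_mul,
        constantCoeff_eq_zero_of_isHomogeneous (hp j) ?_, mul_zero]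
      fin_cases j <;> simp <;> omega
  exact ⟨h, isTjurina_of_relation hf h hp hp0 h₁ h₂ hrel hker (by omega) hτ⟩

/-- A pair of syzygies with cross product a nonzero constant multiple of the gradient is a basis;
with the line at infinity added, the second syzygy has to be multiplied by `X 2`. -/
theorem isFreeWith_of_cross {f : S3} {n d₂ τ τ' : ℕ} {u v : Fin 3 → S3} {c : ℂ} {q : S3}
    (hf : f.IsHomogeneous (n + 1 + d₂ + 1)) (hd : n + 1 ≤ d₂) (hg : IsSaturatedVec (grad f))
    (hu : ∀ i, (u i).IsHomogeneous (n + 1)) (hv : ∀ i, (v i).IsHomogeneous d₂) (hc : c ≠ 0)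
    (h : u ⨯₃ v = (C c : S3) • grad f)
    (hzf : ¬ X 2 ∣ f) (hq : q.IsHomogeneous n) (huq : u 2 = X 2 * q) (hzv : ¬ X 2 ∣ v 2)
    (hτ : τ + (n + 1) * d₂ = (n + 1 + d₂) ^ 2)
    (hτ' : τ' + (n + 1) * (d₂ + 1) = (n + 1 + (d₂ + 1)) ^ 2) :
    (IsFreeWith f (n + 1) d₂ ∧ IsTjurina f τ) ∧
      IsFreeWith (X 2 * f) (n + 1) (d₂ + 1) ∧ IsTjurina (X 2 * f) τ' := by
  have hc' : (C c : S3) ≠ 0 := C_ne_zero.2 hc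
  obtain ⟨hu', hv'⟩ := dotProduct_eq_zero_of_cross hc' h
  rw [← mem_jacSyz_iff_dotProduct] at hu' hv'
  have hgen {w : Fin 3 → S3} (hw : w ∈ jacSyz f) : ∃ a b : S3, w = a • u + b • v := by
    obtain ⟨a, b, hab⟩ := hg.exists_smul_eq hc' h (mem_jacSyz_iff_dotProduct.1 hw)
    refine ⟨C c⁻¹ * a, C c⁻¹ * b, ?_⟩
    rw [mul_smul, mul_smul, ← smul_add, ← hab, ← mul_smul, ← C_mul, inv_mul_cancel₀ hc, C_1,
      one_smul]
  have hind {a b : S3} (hab : a • u + b • v = 0) : a = 0 ∧ b = 0 :=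
    eq_zero_of_smul_add_smul hg.1 hc' h hab
  constructor
  · refine isFreeWith_of_basis (v := ![u, v]) hf hd ?_ ?_ (fun w hw => ?_) (fun c hc => ?_) hτ
    · simp [Fin.forall_fin_two, hu', hv']
    · simpa [Fin.forall_fin_two] using ⟨hu, hv⟩
    · obtain ⟨a, b, rfl⟩ := hgen hw
      exact ⟨![a, b], by simp⟩
    · obtain ⟨h0, h1⟩ := hind (a := c 0) (b := c 1) (by simpa using hc)
      funext j
      fin_cases j
      exacts [h0, h1]
  · have hd0 : n + 1 + d₂ + 1 ≠ 0 := by omega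
    have hw2 : ∀ j, ![u, (X 2 : S3) • v] j ∈ jacSyz f := by
      simp [Fin.forall_fin_two, hu', Submodule.smul_mem _ (X 2 : S3) hv']
    have hwq : ∀ j, ![u, (X 2 : S3) • v] j 2 = X 2 * ![q, v 2] j := by
      simp [Fin.forall_fin_two, huq]
    refine isFreeWith_of_basis
      (v := fun j => addLine (n + 1 + d₂ + 1) (![u, (X 2 : S3) • v] j) (![q, v 2] j))
      ?_ (by omega) (fun j => addLine_mem hf (hw2 j) (hwq j)) ?_
      (fun w hw => exists_eq_sum_addLine hf hd0 hzf hwq (fun w hw hzw => ?_) hw)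
      (fun c hc => ?_) hτ'
    · convert (isHomogeneous_X ℂ (2 : Fin 3)).mul hf using 1
      ring
    · rw [Fin.forall_fin_two]
      refine ⟨isHomogeneous_addLine hu hq, isHomogeneous_addLine (fun i => ?_) (hv 2)⟩
      exact add_comm d₂ 1 ▸ (isHomogeneous_X ℂ (2 : Fin 3)).mul (hv i)
    · obtain ⟨a, b, rfl⟩ := hgen hw
      obtain ⟨b, rfl⟩ : X 2 ∣ b := by
        simp only [Pi.add_apply, Pi.smul_apply, smul_eq_mul, huq] at hzw
        refine (prime_X_two.dvd_or_dvd ((dvd_add_right ?_).1 hzw)).resolve_right hzv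
        exact (dvd_mul_right _ _).mul_left _
      exact ⟨![a, b], by simp [mul_smul, smul_comm b (X 2 : S3)]⟩
    · have := sum_smul_eq_zero_of_addLine hf hd0 hzf hw2 hc
      obtain ⟨h0, h1⟩ := hind (a := c 0) (b := c 1 * X 2) (by simpa [mul_smul] using this)
      funext j
      fin_cases j
      exacts [h0, (mul_eq_zero.1 h1).resolve_right prime_X_two.ne_zero]

/-- Two syzygies `u`, `v` of degree `n + 1` with `u ⨯₃ v = L • grad f`, and a third one `t` with
`L • t = p • u + (X 2 * m) • v`, generate when `(p, X 2 * m)` is regular modulo `L`. -/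
theorem isMPOGWith_of_cross {f : S3} {n τ τ' : ℕ} {u v t : Fin 3 → S3} {L p m q r : S3}
    (hf : f.IsHomogeneous (n + 1 + (n + 1))) (hg : IsSaturatedVec (grad f))
    (hu : ∀ i, (u i).IsHomogeneous (n + 1)) (hv : ∀ i, (v i).IsHomogeneous (n + 1))
    (ht : ∀ i, (t i).IsHomogeneous (n + 1 + 1)) (hL : L.IsHomogeneous 1)
    (hp : p.IsHomogeneous 2) (hm : m.IsHomogeneous 1)
    (hLp : Prime L) (hLdvd : ¬ L ∣ p) (hK : IsKoszulPair L p (X 2 * m))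
    (h : u ⨯₃ v = L • grad f) (hLt : L • t = p • u + (X 2 * m) • v)
    (hzf : ¬ X 2 ∣ f) (hq : q.IsHomogeneous n) (huq : u 2 = X 2 * q)
    (hr : r.IsHomogeneous (n + 1)) (htr : t 2 = X 2 * r) (hzv : ¬ X 2 ∣ v 2)
    (hτ : (τ : ℤ) = (n + 1 + (n + 1) - 1) ^ 2 - (n + 1) * n - 2)
    (hτ' : (τ' : ℤ) = (n + 1 + (n + 1)) ^ 2 - (n + 1) ^ 2 - 1) :
    (IsMPOGWith f (n + 1 + (n + 1)) (n + 1) (n + 1) ∧ IsTjurina f τ) ∧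
      IsNearlyFreeWith (X 2 * f) (n + 1 + (n + 2)) (n + 1) (n + 2) ∧ IsTjurina (X 2 * f) τ' := by
  obtain ⟨hu', hv'⟩ := dotProduct_eq_zero_of_cross hLp.ne_zero h
  rw [← mem_jacSyz_iff_dotProduct] at hu' hv'
  have ht' : t ∈ jacSyz f := by
    have hmem : L • t ∈ jacSyz f :=
      hLt ▸ add_mem (Submodule.smul_mem _ _ hu') (Submodule.smul_mem _ _ hv')
    rw [mem_jacSyz_iff_dotProduct, smul_dotProduct, smul_eq_mul] at hmem
    exact mem_jacSyz_iff_dotProduct.2 ((mul_eq_zero.1 hmem).resolve_left hLp.ne_zero)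
  have hgen {w : Fin 3 → S3} (hw : w ∈ jacSyz f) : ∃ a b c : S3, w = a • u + b • v + c • t :=
    hg.exists_three hLp.ne_zero h hLt hK (mem_jacSyz_iff_dotProduct.1 hw)
  have hker {a b c : S3} (habc : a • u + b • v + c • t = 0) :=
    exists_eq_mul_of_three hg.1 hLp hLdvd h hLt habc
  have hL' : (-L).IsHomogeneous 1 := hL.neg
  have hzm : (X 2 * m).IsHomogeneous 2 := (isHomogeneous_X ℂ (2 : Fin 3)).mul hm
  constructor
  · refine And.imp (fun h => ⟨rfl, _, h⟩) id <|
      isMinGenSyz_of_relation (d₁ := n + 1) (d₂ := n + 1) (d₃ := n + 1 + 1) (r₁ := 2) (r₂ := 2)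
      (τ := τ) (v := ![u, v, t]) (p := ![p, X 2 * m, -L]) hf le_rfl
      (by omega) (by omega) ?_ ?_ (fun w hw => ?_) ?_ ?_ (by omega) (by omega) ?_
      (fun c hc => ?_) ?_
    · simp [Fin.forall_fin_succ, hu', hv', ht']
    · simpa [Fin.forall_fin_succ] using ⟨by simpa [Fin.forall_fin_succ] using hu,
        by simpa [Fin.forall_fin_succ] using hv, by simpa [Fin.forall_fin_succ] using ht⟩
    · obtain ⟨a, b, c, rfl⟩ := hgen hw
      exact ⟨![a, b, c], by simp [Fin.sum_univ_three]⟩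
    · simp [Fin.forall_fin_succ, hp, hzm, hL']
    · simpa using hLp.ne_zero
    · simp [Fin.sum_univ_three, ← hLt]
    · obtain ⟨s, h0, h1, h2⟩ := hker (a := c 0) (b := c 1) (c := c 2)
        (by simpa [Fin.sum_univ_three] using hc)
      refine ⟨s, funext fun j => ?_⟩
      fin_cases j
      exacts [h0, h1, h2]
    · rw [hτ]
      push_cast
      ring
  · have hd0 : n + 1 + (n + 1) ≠ 0 := by omega
    have hw2 : ∀ j, ![u, (X 2 : S3) • v, t] j ∈ jacSyz f := by
      simp [Fin.forall_fin_succ, hu', Submodule.smul_mem _ (X 2 : S3) hv', ht']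
    have hwq : ∀ j, ![u, (X 2 : S3) • v, t] j 2 = X 2 * ![q, v 2, r] j := by
      simp [Fin.forall_fin_succ, huq, htr]
    have hrel : ∑ j, ![p, m, -L] j • ![u, (X 2 : S3) • v, t] j = 0 := by
      simp [Fin.sum_univ_three, hLt, mul_smul, smul_comm m (X 2 : S3)]
    refine And.imp (fun h => ⟨rfl, _, h⟩) id <|
      isMinGenSyz_of_relation (d₁ := n + 1) (d₂ := n + 2) (d₃ := n + 2) (r₁ := 2) (r₂ := 1)
      (τ := τ') (p := ![p, m, -L])
      (v := fun j => addLine (n + 1 + (n + 1)) (![u, (X 2 : S3) • v, t] j) (![q, v 2, r] j))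
      ?_ (by omega) le_rfl (by omega) (fun j => addLine_mem hf (hw2 j) (hwq j)) ?_
      (fun w hw => exists_eq_sum_addLine hf hd0 hzf hwq (fun w hw hzw => ?_) hw)
      ?_ ?_ (by omega) (by omega) ?_ (fun c hc => ?_) ?_
    · convert (isHomogeneous_X ℂ (2 : Fin 3)).mul hf using 1
      ring
    · refine fun j => ?_
      fin_cases j
      · exact isHomogeneous_addLine hu hq
      · refine isHomogeneous_addLine (fun i => ?_) (hv 2)
        exact add_comm (n + 1) 1 ▸ (isHomogeneous_X ℂ (2 : Fin 3)).mul (hv i)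
      · exact isHomogeneous_addLine ht hr
    · obtain ⟨a, b, c, rfl⟩ := hgen hw
      obtain ⟨b, rfl⟩ : X 2 ∣ b := by
        obtain ⟨s, hs⟩ := hzw
        simp only [Pi.add_apply, Pi.smul_apply, smul_eq_mul, huq, htr] at hs
        refine (prime_X_two.dvd_or_dvd (⟨s - a * q - c * r, ?_⟩ : X 2 ∣ b * v 2)).resolve_right hzv
        linear_combination hs
      exact ⟨![a, b, c], by simp [Fin.sum_univ_three, mul_smul, smul_comm b (X 2 : S3)]⟩
    · simp [Fin.forall_fin_succ, hp, hm, hL']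
    · simpa using hLp.ne_zero
    · have hsum : ∑ j, ![p, m, -L] j * ![q, v 2, r] j = 0 := by
        refine (mul_eq_zero.1 ?_).resolve_left prime_X_two.ne_zero
        simpa [hwq, Finset.mul_sum, mul_left_comm] using congrFun hrel 2
      rw [sum_addLine, hrel, hsum]
      funext i
      simp
    · have := sum_smul_eq_zero_of_addLine hf hd0 hzf hw2 hc
      obtain ⟨s, h0, h1, h2⟩ := hker (a := c 0) (b := c 1 * X 2) (c := c 2)
        (by simpa [Fin.sum_univ_three, mul_smul] using this)
      refine ⟨s, funext fun j => ?_⟩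
      fin_cases j
      · exact h0
      · refine mul_right_cancel₀ prime_X_two.ne_zero ?_
        simp only [Fin.mk_one, h1, Pi.smul_apply, cons_val, smul_eq_mul]
        ring
      · exact h2
    · rw [hτ']
      push_cast
      ring

end Criteria

/-! ### Forms given by lists of terms -/

/-- A term `(c, i, j, k)` stands for `c * x ^ i * y ^ j * z ^ k`. -/
abbrev Term := ℤ × ℕ × ℕ × ℕ

/-- The value at `(x, y, z)` of a sum of terms. -/
def form {R : Type*} [CommRing R] (x y z : R) (l : List Term) : R :=
  (l.map fun t => (t.1 : R) * x ^ t.2.1 * y ^ t.2.2.1 * z ^ t.2.2.2).sum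

/-- The polynomial with terms `l`. -/
def toPoly (l : List Term) : S3 := form (X 0) (X 1) (X 2) l

theorem isHomogeneous_toPoly {l : List Term} {n : ℕ}
    (h : ∀ t ∈ l, t.2.1 + t.2.2.1 + t.2.2.2 = n) : (toPoly l).IsHomogeneous n := by
  induction l with
  | nil => simpa [toPoly, form] using isHomogeneous_zero (Fin 3) ℂ n
  | cons t l ih =>
    have ht : ((t.1 : S3) * X 0 ^ t.2.1 * X 1 ^ t.2.2.1 * X 2 ^ t.2.2.2).IsHomogeneous n := by
      have := (((isHomogeneous_C (Fin 3) (t.1 : ℂ)).mul (isHomogeneous_X_pow 0 t.2.1)).mul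
        (isHomogeneous_X_pow 1 t.2.2.1)).mul (isHomogeneous_X_pow 2 t.2.2.2)
      rwa [zero_add, h t (by simp), map_intCast] at this
    exact ht.add (ih fun s hs => h s (by simp [hs]))

theorem eval_toPoly (a : Fin 3 → ℂ) (l : List Term) :
    eval a (toPoly l) = form (a 0) (a 1) (a 2) l := by
  simp [toPoly, form, map_list_sum, Function.comp_def]

theorem not_X_dvd_of_eval {p : S3} (h : eval ![1, 1, 0] p ≠ 0) : ¬ X 2 ∣ p := by
  rintro ⟨q, rfl⟩
  simp at h

/-- The terms of the partial derivative of a form. -/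
def derivTerm (t : Term) : Fin 3 → Term :=
  ![(t.1 * t.2.1, t.2.1 - 1, t.2.2.1, t.2.2.2), (t.1 * t.2.2.1, t.2.1, t.2.2.1 - 1, t.2.2.2),
    (t.1 * t.2.2.2, t.2.1, t.2.2.1, t.2.2.2 - 1)]

theorem pderiv_toPoly (i : Fin 3) (l : List Term) :
    pderiv i (toPoly l) = toPoly (l.map (derivTerm · i)) := by
  simp only [toPoly, form, map_list_sum, List.map_map]
  congr 1
  refine List.map_congr_left fun t _ => ?_
  simp only [Function.comp_apply, ← map_intCast (C : ℂ →+* S3), Derivation.leibniz, pderiv_C,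
    Derivation.leibniz_pow, pderiv_X, smul_eq_mul, nsmul_eq_mul]
  fin_cases i <;> simp [derivTerm] <;> ring

/-- The quotient of a term by `z`. -/
def lowerZ (t : Term) : Term := (t.1, t.2.1, t.2.2.1, t.2.2.2 - 1)

theorem toPoly_eq_X_two_mul {l : List Term} (h : ∀ t ∈ l, t.2.2.2 ≠ 0) :
    toPoly l = X 2 * toPoly (l.map lowerZ) := by
  simp only [toPoly, form, List.map_map, ← List.sum_map_mul_left]
  congr 1
  refine List.map_congr_left fun t ht => ?_
  simp only [Function.comp_apply, lowerZ]
  conv_lhs => rw [← Nat.sub_one_add_one (h t ht), pow_succ]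
  ring

theorem isHomogeneous_toPoly_lowerZ {l : List Term} {n : ℕ} (h : ∀ t ∈ l, t.2.2.2 ≠ 0)
    (hn : ∀ t ∈ l, t.2.1 + t.2.2.1 + t.2.2.2 = n + 1) :
    (toPoly (l.map lowerZ)).IsHomogeneous n := by
  refine isHomogeneous_toPoly fun t ht => ?_
  obtain ⟨s, hs, rfl⟩ := List.mem_map.1 ht
  have h1 := h s hs
  have h2 := hn s hs
  simp only [lowerZ]
  omega

theorem form_intCast (a : Fin 3 → ℤ) (l : List Term) :
    form (a 0 : ℂ) (a 1) (a 2) l = (form (a 0) (a 1) (a 2) l : ℤ) := by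
  simp [form, Function.comp_def]

theorem not_X_two_dvd_toPoly {l : List Term} (h : form 1 1 0 l ≠ (0 : ℤ)) : ¬ X 2 ∣ toPoly l := by
  have h' := form_intCast ![1, 1, 0] l
  simp only [Matrix.cons_val, Int.cast_one, Int.cast_zero] at h'
  refine not_X_dvd_of_eval ?_
  simp only [eval_toPoly, Matrix.cons_val, h']
  exact_mod_cast h

/-- The terms of `5 * f0''`. -/
def termsF : List Term :=
  [(5, 10, 6, 0), (30, 9, 5, 2), (25, 8, 5, 3), (75, 8, 4, 4), (125, 7, 4, 5), (100, 7, 3, 6),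
   (50, 6, 4, 6), (250, 6, 3, 7), (75, 6, 2, 8), (184, 5, 3, 8), (250, 5, 2, 9), (30, 5, 1, 10),
   (50, 4, 3, 9), (252, 4, 2, 10), (125, 4, 1, 11), (5, 4, 0, 12), (110, 3, 2, 11),
   (152, 3, 1, 12), (25, 3, 0, 13), (25, 2, 2, 12), (70, 2, 1, 13), (34, 2, 0, 14),
   (20, 1, 1, 14), (10, 1, 0, 15), (5, 0, 1, 15), (-5, 0, 0, 16)]

/-- The syzygy of degree `7` of `fb''`. -/
def termsU : Fin 3 → List Term := ![
  [(1560, 5, 2, 0), (3120, 4, 1, 2), (2408, 3, 1, 3), (1560, 3, 0, 4), (2408, 2, 0, 5),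
   (763, 1, 0, 6)],
  [(-2600, 4, 3, 0), (-6480, 3, 2, 2), (-3880, 2, 2, 3), (-5160, 2, 1, 4), (-5752, 1, 1, 5),
   (-1280, 1, 0, 6), (-1125, 0, 1, 6), (-1872, 0, 0, 7)],
  [(120, 4, 2, 1), (240, 3, 1, 3), (200, 2, 1, 4), (120, 2, 0, 5), (200, 1, 0, 6), (75, 0, 0, 7)]]

/-- The syzygy of degree `8` of `fb''`. -/
def termsV : Fin 3 → List Term := ![
  [(1560, 6, 2, 0), (-4680, 5, 3, 0), (-3120, 5, 2, 1), (3120, 5, 1, 2), (-12, 4, 2, 2),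
   (-3832, 4, 1, 3), (1560, 4, 0, 4), (-7224, 3, 2, 3), (9200, 3, 1, 4), (-712, 3, 0, 5),
   (5233, 2, 1, 5), (5295, 2, 0, 6), (-2289, 1, 1, 6), (947, 1, 0, 7), (1664, 0, 0, 8)],
  [(-2600, 5, 3, 0), (7800, 4, 4, 0), (6160, 4, 3, 1), (-6480, 4, 2, 2), (5060, 3, 3, 2),
   (11960, 3, 2, 3), (-5160, 3, 1, 4), (11640, 2, 3, 3), (-9472, 2, 2, 4), (7448, 2, 1, 5),
   (-1280, 2, 0, 6), (241, 1, 2, 5), (-8065, 1, 1, 6), (1648, 1, 0, 7), (3375, 0, 2, 6),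
   (835, 0, 1, 7), (-208, 0, 0, 8)],
  [(-480, 5, 3, 0), (120, 5, 2, 1), (-360, 4, 3, 1), (-1680, 4, 2, 2), (240, 4, 1, 3),
   (-1260, 3, 2, 3), (-1720, 3, 1, 4), (120, 3, 0, 5), (-600, 2, 2, 4), (-1840, 2, 1, 5),
   (-520, 2, 0, 6), (-575, 1, 1, 6), (-865, 1, 0, 7), (-225, 0, 1, 7), (-125, 0, 0, 8)]]

/-- A syzygy of degree `8` of `f0''` with last entry divisible by `z`. -/
def termsUZero : Fin 3 → List Term := ![
  [(2381316096, 6, 2, 0), (2925000, 5, 3, 0), (-568688640, 5, 2, 1), (4762632192, 5, 1, 2),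
   (76698000, 4, 2, 2), (2831482880, 4, 1, 3), (2381316096, 4, 0, 4), (4515000, 3, 2, 3),
   (-599711800, 3, 1, 4), (3400171520, 3, 0, 5), (101801400, 2, 1, 5), (814837760, 2, 0, 6),
   (1430625, 1, 1, 6), (31575040, 1, 0, 7), (9830400, 0, 0, 8)],
  [(-3968860160, 5, 3, 0), (-4875000, 4, 4, 0), (947814400, 4, 3, 1), (-9525264384, 4, 2, 2),
   (-130230000, 3, 3, 2), (-3678535680, 3, 2, 3), (-7143948288, 3, 1, 4), (-7275000, 2, 3, 3),
   (784526600, 2, 2, 4), (-6231654400, 2, 1, 5), (-1587544064, 2, 0, 6), (-159489000, 1, 2, 5),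
   (-311791360, 1, 1, 6), (-1605304320, 1, 0, 7), (-2109375, 0, 2, 6), (-305487600, 0, 1, 7),
   (266649600, 0, 0, 8)],
  [(225000, 4, 3, 1), (2946000, 3, 2, 3), (375000, 2, 2, 4), (14906600, 2, 1, 5),
   (3735000, 1, 1, 6), (12185600, 1, 0, 7), (140625, 0, 1, 7), (17894400, 0, 0, 8)]]

/-- A syzygy of degree `8` of `f0''` with last entry not divisible by `z`. -/
def termsVZero : Fin 3 → List Term := ![
  [(1572864, 6, 2, 0), (234000, 5, 3, 0), (-4233216, 5, 2, 1), (3145728, 5, 1, 2),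
   (3583836, 4, 2, 2), (-5844992, 4, 1, 3), (1572864, 4, 0, 4), (361200, 3, 2, 3),
   (-455288, 3, 1, 4), (-1611776, 3, 0, 5), (4743351, 2, 1, 5), (-2822084, 2, 0, 6),
   (114450, 1, 1, 6), (-1636537, 1, 0, 7), (332160, 0, 0, 8)],
  [(-2621440, 5, 3, 0), (-390000, 4, 4, 0), (6793280, 4, 3, 1), (-6291456, 4, 2, 2),
   (-6492660, 3, 3, 2), (12214464, 3, 2, 3), (-4718592, 3, 1, 4), (-582000, 2, 3, 3),
   (-4555304, 2, 2, 4), (6670528, 2, 1, 5), (-1048576, 2, 0, 6), (-8114025, 1, 2, 5),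
   (890572, 1, 1, 6), (1249344, 1, 0, 7), (-168750, 0, 2, 6), (-2077305, 0, 1, 7),
   (326256, 0, 0, 8)],
  [(131040, 5, 3, 0), (18000, 4, 3, 1), (393120, 4, 2, 2), (383100, 3, 2, 3), (393120, 3, 1, 4),
   (30000, 2, 2, 4), (718600, 2, 1, 5), (131040, 2, 0, 6), (291975, 1, 1, 6), (353500, 1, 0, 7),
   (11250, 0, 1, 7), (61911, 0, 0, 8)]]

/-- A syzygy of degree `9` of `f0''`. -/
def termsTZero : Fin 3 → List Term := ![
  [(990, 6, 3, 0), (1434, 5, 2, 2), (2427, 4, 2, 3), (-102, 4, 1, 4), (2294, 3, 1, 5),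
   (-546, 3, 0, 6), (1682, 2, 1, 6), (-133, 2, 0, 7), (-94, 1, 0, 8), (160, 0, 0, 9)],
  [(-1650, 5, 4, 0), (-3110, 4, 3, 2), (-3845, 3, 3, 3), (-966, 3, 2, 4), (-5418, 2, 2, 5),
   (798, 2, 1, 6), (-2350, 1, 2, 6), (-1861, 1, 1, 7), (304, 1, 0, 8), (-670, 0, 1, 8),
   (-288, 0, 0, 9)],
  [(30, 5, 3, 1), (90, 4, 2, 3), (75, 3, 2, 4), (90, 3, 1, 5), (150, 2, 1, 6), (30, 2, 0, 7),
   (50, 1, 1, 7), (75, 1, 0, 8), (2, 0, 0, 9)]]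

/-- The quadratic coefficient in the relation between the syzygies of `f0''`. -/
def termsPZero : List Term :=
  [(-21621600, 1, 1, 0), (7864320, 1, 0, 1), (-1800000, 0, 1, 1), (-9241440, 0, 0, 2)]

/-- A syzygy of degree `8` of `f1''` with last entry divisible by `z`. -/
def termsUOne : Fin 3 → List Term := ![
  [(6582160896, 6, 2, 0), (2925000, 5, 3, 0), (-1119776640, 5, 2, 1), (13164321792, 5, 1, 2),
   (104373000, 4, 2, 2), (8730714880, 4, 1, 3), (6582160896, 4, 0, 4), (4515000, 3, 2, 3),
   (-1309931800, 3, 1, 4), (9850491520, 3, 0, 5), (139803900, 2, 1, 5), (2009125160, 2, 0, 6),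
   (1430625, 1, 1, 6), (43330540, 1, 0, 7), (13670400, 0, 0, 8)],
  [(-10970268160, 5, 3, 0), (-4875000, 4, 4, 0), (1866294400, 4, 3, 1), (-26328643584, 4, 2, 2),
   (-176355000, 3, 3, 2), (-11976295680, 3, 2, 3), (-19746482688, 3, 1, 4), (-7275000, 2, 3, 3),
   (1794746600, 2, 2, 4), (-18581206400, 2, 1, 5), (-4388107264, 2, 0, 6), (-217576500, 1, 2, 5),
   (-407638360, 1, 1, 6), (-4738616320, 1, 0, 7), (-2109375, 0, 2, 6), (-553610100, 0, 1, 7),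
   (1046640000, 0, 0, 8)],
  [(225000, 4, 3, 1), (3921000, 3, 2, 3), (375000, 2, 2, 4), (26426600, 2, 1, 5),
   (5047500, 1, 1, 6), (22730600, 1, 0, 7), (140625, 0, 1, 7), (33561900, 0, 0, 8)]]

/-- A syzygy of degree `8` of `f1''` with last entry not divisible by `z`. -/
def termsVOne : Fin 3 → List Term := ![
  [(-3041664, 6, 2, 0), (117000, 5, 3, 0), (-2964768, 5, 2, 1), (-6083328, 5, 1, 2),
   (2314668, 4, 2, 2), (-31402048, 4, 1, 3), (-3041664, 4, 0, 4), (180600, 3, 2, 3),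
   (-2772244, 3, 1, 4), (-28437280, 3, 0, 5), (3113213, 2, 1, 5), (-9951064, 2, 0, 6),
   (57225, 1, 1, 6), (-2294021, 1, 0, 7), (215680, 0, 0, 8)],
  [(5069440, 5, 3, 0), (-195000, 4, 4, 0), (4750240, 4, 3, 1), (12166656, 4, 2, 2),
   (-4192580, 3, 3, 2), (52895232, 3, 2, 3), (9124992, 3, 1, 4), (-291000, 2, 3, 3),
   (1008748, 2, 2, 4), (66067232, 2, 1, 5), (2027776, 2, 0, 6), (-5317075, 1, 2, 5),
   (8149496, 1, 1, 6), (17922240, 1, 0, 7), (-84375, 0, 2, 6), (-23365, 0, 1, 7),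
   (-1837984, 0, 0, 8)],
  [(95520, 5, 3, 0), (9000, 4, 3, 1), (286560, 4, 2, 2), (264300, 3, 2, 3), (286560, 3, 1, 4),
   (15000, 2, 2, 4), (492700, 2, 1, 5), (95520, 2, 0, 6), (196925, 1, 1, 6), (237400, 1, 0, 7),
   (5625, 0, 1, 7), (-43957, 0, 0, 8)]]

/-- A syzygy of degree `9` of `f1''`. -/
def termsTOne : Fin 3 → List Term := ![
  [(3960, 6, 3, 0), (3336, 5, 2, 2), (9708, 4, 2, 3), (-30840, 4, 1, 4), (5176, 3, 1, 5),
   (-30216, 3, 0, 6), (6728, 2, 1, 6), (-8804, 2, 0, 7), (-1651, 1, 0, 8), (640, 0, 0, 9)],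
  [(-6600, 5, 4, 0), (-8440, 4, 3, 2), (-15380, 3, 3, 3), (48456, 3, 2, 4), (-15672, 2, 2, 5),
   (70200, 2, 1, 6), (-9400, 1, 2, 6), (556, 1, 1, 7), (19904, 1, 0, 8), (-1555, 0, 1, 8),
   (-3424, 0, 0, 9)],
  [(120, 5, 3, 1), (360, 4, 2, 3), (300, 3, 2, 4), (360, 3, 1, 5), (600, 2, 1, 6),
   (120, 2, 0, 7), (200, 1, 1, 7), (300, 1, 0, 8), (-67, 0, 0, 9)]]

/-- The quadratic coefficient in the relation between the syzygies of `f1''`. -/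
def termsPOne : List Term :=
  [(-63043200, 1, 1, 0), (-60833280, 1, 0, 1), (-3600000, 0, 1, 1), (13681920, 0, 0, 2)]

/-- The first two entries of a syzygy of degree `16` of `f0'' * fb''`. -/
def termsR : Fin 2 → List Term := ![
  [(1152480, 11, 5, 0), (219750, 10, 6, 0), (-164850, 10, 5, 1), (5762400, 10, 4, 2),
   (1089375, 9, 5, 2), (3977750, 9, 4, 3), (11524800, 9, 3, 4), (915625, 8, 5, 3),
   (1463750, 8, 4, 4), (17559500, 8, 3, 5), (11524800, 8, 2, 6), (3625000, 7, 4, 5),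
   (7039450, 7, 3, 6), (27163500, 7, 2, 7), (5762400, 7, 1, 8), (1465000, 6, 4, 6),
   (4302750, 6, 3, 7), (18089382, 6, 2, 8), (18383750, 6, 1, 9), (1152480, 6, 0, 10),
   (3987150, 5, 3, 8), (6340660, 5, 2, 9), (16787039, 5, 1, 10), (4637150, 5, 0, 11),
   (1098750, 4, 3, 9), (2855600, 4, 2, 10), (6621665, 4, 1, 11), (5142982, 4, 0, 12),
   (1574000, 3, 2, 11), (1970150, 3, 1, 12), (1874380, 3, 0, 13), (366250, 2, 2, 12),
   (288050, 2, 1, 13), (484220, 2, 0, 14), (137125, 1, 1, 14), (116930, 1, 0, 15),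
   (36625, 0, 1, 15), (-15600, 0, 0, 16)],
  [(-1920800, 10, 6, 0), (-366250, 9, 7, 0), (277250, 9, 6, 1), (-10372320, 9, 5, 2),
   (-1959000, 8, 6, 2), (-6184550, 8, 5, 3), (-23049600, 8, 4, 4), (-1465000, 7, 6, 3),
   (-3180375, 7, 5, 4), (-30279500, 7, 4, 5), (-26891200, 7, 3, 6), (-6334375, 6, 5, 5),
   (-11547300, 6, 4, 6), (-53727500, 6, 3, 7), (-17287200, 6, 2, 8), (-2197500, 5, 5, 6),
   (-9078500, 5, 4, 7), (-29990220, 5, 3, 8), (-45509750, 5, 2, 9), (-5762400, 5, 1, 10),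
   (-6626500, 4, 4, 8), (-11442050, 4, 3, 9), (-32640828, 4, 2, 10), (-18368750, 4, 1, 11),
   (-768320, 4, 0, 12), (-1465000, 3, 4, 9), (-6138850, 3, 3, 10), (-10587820, 3, 2, 11),
   (-14788571, 3, 1, 12), (-2768800, 3, 0, 13), (-2342250, 2, 3, 11), (-3548600, 2, 2, 12),
   (-3354895, 2, 1, 13), (-2178288, 2, 0, 14), (-366250, 1, 3, 12), (-762000, 1, 2, 13),
   (-686270, 1, 1, 14), (-127750, 0, 2, 14)]]

/-! ### The pencil of curves -/

/-- The members `f''₀ + e z¹⁶` of the pencil spanned by `f''₀` and `z¹⁶`. -/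
def fiber (e : ℂ) : S3 := f0'' + C e * X 2 ^ 16

theorem fiber_zero : fiber 0 = f0'' := by simp [fiber]

theorem fiber_neg_one : fiber (-1) = f1'' := by simp [fiber, f1'', sub_eq_add_neg]

/-- The terms of `25 f''₀ + n z¹⁶`. -/
def fiberTerms (n : ℤ) : List Term := (n, 0, 0, 16) :: termsF.map fun t => (5 * t.1, t.2)

theorem fiber_eq_toPoly {e : ℂ} {n : ℤ} (h : 25 * e = n) :
    25 * fiber e = toPoly (fiberTerms n) := by
  have hC (a : ℂ) (m : S3) (ha : C (5 * a) = m) : 5 * (C a : S3) = m := by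
    rw [← ha, C_mul, map_ofNat]
  have h₁ := hC (184 / 5) 184 (by rw [← map_ofNat C 184]; norm_num)
  have h₂ := hC (252 / 5) 252 (by rw [← map_ofNat C 252]; norm_num)
  have h₃ := hC (152 / 5) 152 (by rw [← map_ofNat C 152]; norm_num)
  have h₄ := hC (34 / 5) 34 (by rw [← map_ofNat C 34]; norm_num)
  have h₅ : 25 * (C e : S3) = n := by rw [← map_ofNat C 25, ← C_mul, h, map_intCast]
  simp only [fiber, f0'', toPoly, form, fiberTerms, termsF, List.map_cons, List.map_nil,
    List.sum_cons, List.sum_nil]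
  push_cast
  linear_combination 5 * X 0 ^ 5 * X 1 ^ 3 * X 2 ^ 8 * h₁ + 5 * X 0 ^ 4 * X 1 ^ 2 * X 2 ^ 10 * h₂ +
    5 * X 0 ^ 3 * X 1 * X 2 ^ 12 * h₃ + 5 * X 0 ^ 2 * X 2 ^ 14 * h₄ + X 2 ^ 16 * h₅

theorem grad_fiber {e : ℂ} {n : ℤ} (h : 25 * e = n) (i : Fin 3) :
    25 * grad (fiber e) i = toPoly ((fiberTerms n).map (derivTerm · i)) := by
  rw [← pderiv_toPoly, ← fiber_eq_toPoly h, ← map_ofNat C 25, pderiv_C_mul, grad]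

theorem isHomogeneous_f0'' : f0''.IsHomogeneous 16 := by
  have h := (isHomogeneous_C (Fin 3) (25⁻¹ : ℂ)).mul
    (isHomogeneous_toPoly (l := fiberTerms 0) (n := 16) (by decide))
  rw [← fiber_eq_toPoly (e := 0) (by simp), fiber_zero, ← mul_assoc, ← map_ofNat C 25, ← C_mul] at h
  simpa using h

theorem isHomogeneous_fiber (e : ℂ) : (fiber e).IsHomogeneous 16 :=
  isHomogeneous_f0''.add <| by
    simpa using (isHomogeneous_C _ e).mul (isHomogeneous_X_pow (2 : Fin 3) 16)

theorem eval_fiber (e : ℂ) : eval ![1, 1, 0] (fiber e) = 1 := by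
  simp [fiber, f0'']

theorem not_X_dvd_fiber (e : ℂ) : ¬ X 2 ∣ fiber e :=
  not_X_dvd_of_eval (by simp [eval_fiber])

theorem grad_fiber_zero (e : ℂ) : grad (fiber e) 0 = grad f0'' 0 := by
  simp [grad, fiber, pderiv_X]

theorem grad_fiber_one (e : ℂ) : grad (fiber e) 1 = grad f0'' 1 := by
  simp [grad, fiber, pderiv_X]

theorem not_X_dvd_grad_f0'' : ¬ X 2 ∣ grad f0'' 0 := by
  have h := congrArg (eval ![1, 1, 0]) (grad_fiber (e := 0) (n := 0) (by simp) 0)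
  rw [fiber_zero, eval_toPoly] at h
  refine not_X_dvd_of_eval fun h0 => ?_
  simp [h0, form, fiberTerms, termsF, derivTerm] at h

/-- The first coefficient expressing a power of `z` by the first two partial derivatives. -/
def zCoeffX : S3 := 6 * X 0 ^ 4 * X 1 + 6 * X 0 ^ 3 * X 2 ^ 2 + X 0 ^ 2 * X 2 ^ 3

/-- The second coefficient expressing a power of `z` by the first two partial derivatives. -/
def zCoeffY : S3 :=
  -10 * X 0 ^ 3 * X 1 ^ 2 - 14 * X 0 ^ 2 * X 1 * X 2 ^ 2 - 4 * X 0 * X 2 ^ 4 + X 2 ^ 5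

theorem zCoeff_spec : zCoeffX * grad f0'' 0 + zCoeffY * grad f0'' 1 = X 2 ^ 20 := by
  have h0 := grad_fiber (e := 0) (n := 0) (by simp) 0
  have h1 := grad_fiber (e := 0) (n := 0) (by simp) 1
  rw [fiber_zero] at h0 h1
  have key {R : Type} [CommRing R] (x y z : R) :
      (6 * x ^ 4 * y + 6 * x ^ 3 * z ^ 2 + x ^ 2 * z ^ 3) *
          form x y z ((fiberTerms 0).map (derivTerm · 0)) +
        (-10 * x ^ 3 * y ^ 2 - 14 * x ^ 2 * y * z ^ 2 - 4 * x * z ^ 4 + z ^ 5) *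
          form x y z ((fiberTerms 0).map (derivTerm · 1)) = 25 * z ^ 20 := by
    simp only [form, fiberTerms, termsF, derivTerm, List.map_cons, List.map_nil, List.sum_cons,
      List.sum_nil, Matrix.cons_val]
    push_cast
    ring
  have key' := key (X 0 : S3) (X 1) (X 2)
  rw [toPoly] at h0 h1
  refine mul_left_cancel₀ (OfNat.ofNat_ne_zero 25 : (25 : S3) ≠ 0) ?_
  rw [← key', ← h0, ← h1, zCoeffX, zCoeffY]
  ring

theorem isSaturatedVec_grad_fiber (e : ℂ) : IsSaturatedVec (grad (fiber e)) := by
  refine isSaturatedVec_of_pow (v := ![zCoeffX, zCoeffY, 0]) (N := 20) prime_X_two ?_ ?_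
  · rw [grad_fiber_zero]
    exact not_X_dvd_grad_f0''
  · rw [Matrix.vec3_dotProduct, grad_fiber_zero, grad_fiber_one, ← zCoeff_spec]
    simp

/-! ### The free member of the pencil -/

theorem isHomogeneous_toPoly_of_forall {l : Fin 3 → List Term} {n : ℕ}
    (h : ∀ i, ∀ t ∈ l i, t.2.1 + t.2.2.1 + t.2.2.2 = n) (i : Fin 3) :
    (toPoly (l i)).IsHomogeneous n :=
  isHomogeneous_toPoly (h i)

open Matrix in
/-- An identity between cross products of polynomial vectors may be checked on the lists of terms
over an arbitrary ring. -/
theorem cross_toPoly {e : ℂ} {n : ℤ} (he : 25 * e = n) {u v : Fin 3 → List Term} {l : List Term}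
    (h : ∀ x y z : S3, (25 : S3) • ((fun i => form x y z (u i)) ⨯₃ fun i => form x y z (v i)) =
      form x y z l • fun i => form x y z ((fiberTerms n).map (derivTerm · i))) :
    (fun i => toPoly (u i)) ⨯₃ (fun i => toPoly (v i)) = toPoly l • grad (fiber e) := by
  funext i
  have hi := congrFun (h (X 0) (X 1) (X 2)) i
  have hg := grad_fiber he i
  refine mul_left_cancel₀ (OfNat.ofNat_ne_zero 25 : (25 : S3) ≠ 0) ?_
  simp only [Pi.smul_apply, smul_eq_mul, toPoly] at hi hg ⊢
  rw [hi, ← hg]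
  ring

open Matrix in
theorem isFreeWith_fb'' : (IsFreeWith fb'' 7 8 ∧ IsTjurina fb'' 169) ∧
    IsFreeWith (X 2 * fb'') 7 9 ∧ IsTjurina (X 2 * fb'') 193 := by
  have h : (fun i => toPoly (termsU i)) ⨯₃ (fun i => toPoly (termsV i)) =
      toPoly [(124800, 0, 0, 0)] • grad (fiber (64 / 25)) := by
    refine cross_toPoly (n := 64) (by norm_num) fun x y z => ?_
    rw [cross_apply]
    ext i : 1
    fin_cases i <;>
    · simp [form, fiberTerms, termsF, derivTerm, termsU, termsV]
      ring
  have hc : toPoly [(124800, 0, 0, 0)] = C 124800 := by simp [toPoly, form, map_ofNat]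
  rw [hc] at h
  exact isFreeWith_of_cross (n := 6) (d₂ := 8) (isHomogeneous_fiber _) (by norm_num)
    (isSaturatedVec_grad_fiber _) (isHomogeneous_toPoly_of_forall (by decide))
    (isHomogeneous_toPoly_of_forall (by decide)) (by norm_num) h (not_X_dvd_fiber _)
    (isHomogeneous_toPoly (l := (termsU 2).map lowerZ) (by decide))
    (toPoly_eq_X_two_mul (by decide))
    (not_X_two_dvd_toPoly (by decide)) (by norm_num) (by norm_num)

/-! ### The minimal plus-one generated members of the pencil -/

/-- The terms of the linear form with coefficients `l`. -/
def linTerms (l : Fin 3 → ℤ) : List Term := [(l 0, 1, 0, 0), (l 1, 0, 1, 0), (l 2, 0, 0, 1)]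

theorem toPoly_linTerms (l : Fin 3 → ℤ) : toPoly (linTerms l) = linForm fun i => (l i : ℂ) := by
  simp [toPoly, form, linTerms, linForm, Fin.sum_univ_three, add_assoc]

open Matrix in
theorem cross_intCast (l m : Fin 3 → ℤ) :
    (fun i => (l i : ℂ)) ⨯₃ (fun i => (m i : ℂ)) = fun i => ((l ⨯₃ m) i : ℂ) := by
  rw [cross_apply, cross_apply]
  ext i
  fin_cases i <;> simp

open Matrix in
theorem not_mem_span_linTerms {l m : Fin 3 → ℤ} {p : List Term}
    (h : form ((l ⨯₃ m) 0) ((l ⨯₃ m) 1) ((l ⨯₃ m) 2) p ≠ 0) :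
    toPoly p ∉ Ideal.span {toPoly (linTerms l), toPoly (linTerms m)} := by
  rw [toPoly_linTerms, toPoly_linTerms]
  refine not_mem_span_linForm ?_
  rw [cross_intCast, eval_toPoly, form_intCast]
  exact_mod_cast h

open Matrix in
theorem isPrime_span_linTerms {l m : Fin 3 → ℤ} (h : (l ⨯₃ m) 0 ≠ 0) :
    (Ideal.span {toPoly (linTerms l), toPoly (linTerms m)}).IsPrime := by
  rw [toPoly_linTerms, toPoly_linTerms]
  refine isPrime_span_linForm ?_
  simpa only [cross_intCast, ne_eq, Int.cast_eq_zero] using h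

theorem X_two_eq_toPoly : (X 2 : S3) = toPoly (linTerms ![0, 0, 1]) := by
  simp [toPoly, form, linTerms]

open Matrix in
theorem not_toPoly_linTerms_dvd {l a : Fin 3 → ℤ} {p : List Term} (ha : l ⬝ᵥ a = 0)
    (h : form (a 0) (a 1) (a 2) p ≠ 0) : ¬ toPoly (linTerms l) ∣ toPoly p := by
  rintro ⟨q, hq⟩
  have := congrArg (eval fun i => (a i : ℂ)) hq
  rw [map_mul, toPoly_linTerms, eval_linForm, eval_toPoly, form_intCast] at this
  have h0 : (fun i => (l i : ℂ)) ⬝ᵥ (fun i => (a i : ℂ)) = ((l ⬝ᵥ a : ℤ) : ℂ) := by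
    simp [dotProduct]
  rw [h0, ha, Int.cast_zero, zero_mul] at this
  exact h (by exact_mod_cast this)

open Matrix in
/-- The numerical criterion for `L, p, z m` with `L`, `m` linear to be a Koszul pair. -/
theorem isKoszulPair_linTerms {l m : Fin 3 → ℤ} {p : List Term} (hl0 : l 0 ≠ 0) (hl1 : l 1 ≠ 0)
    (h0 : (l ⨯₃ m) 0 ≠ 0) (h2 : (l ⨯₃ m) 2 ≠ 0) (hz : form (l 1) (-l 0) 0 p ≠ 0)
    (hm : form ((l ⨯₃ m) 0) ((l ⨯₃ m) 1) ((l ⨯₃ m) 2) p ≠ 0) :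
    Prime (toPoly (linTerms l)) ∧ ¬ toPoly (linTerms l) ∣ toPoly p ∧
      IsKoszulPair (toPoly (linTerms l)) (toPoly p) (X 2 * toPoly (linTerms m)) := by
  have ha : l ⬝ᵥ ![l 1, -l 0, 0] = 0 := by
    rw [vec3_dotProduct]
    simp [mul_comm]
  have hb : l ⨯₃ ![0, 0, 1] = ![l 1, -l 0, 0] := by
    simp [cross_apply]
  have hL : Prime (toPoly (linTerms l)) := by
    rw [toPoly_linTerms]
    exact prime_linForm (by exact_mod_cast hl0)
  refine ⟨hL, not_toPoly_linTerms_dvd ha hz, ?_⟩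
  rw [X_two_eq_toPoly]
  refine isKoszulPair_mul hL (not_toPoly_linTerms_dvd (dot_self_cross l m) ?_)
    (not_toPoly_linTerms_dvd ha ?_) (isPrime_span_linTerms (by simpa [hb]))
    (isPrime_span_linTerms h0) (not_mem_span_linTerms (by simpa [hb])) (not_mem_span_linTerms hm)
  · simpa [form, linTerms] using h2
  · rw [cross_apply] at h2
    contrapose! h2
    simp [form, linTerms] at h2 ⊢
    linear_combination -h2

open Matrix in
/-- The numerical criterion for a member of the pencil to be a minimal plus-one generated curve. -/
theorem isMPOGWith_fiber {e : ℂ} {n : ℤ} (he : 25 * e = n) {u v t : Fin 3 → List Term}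
    {p : List Term} {l m : Fin 3 → ℤ}
    (hu : ∀ i, ∀ s ∈ u i, s.2.1 + s.2.2.1 + s.2.2.2 = 8)
    (hv : ∀ i, ∀ s ∈ v i, s.2.1 + s.2.2.1 + s.2.2.2 = 8)
    (ht : ∀ i, ∀ s ∈ t i, s.2.1 + s.2.2.1 + s.2.2.2 = 9)
    (hp : ∀ s ∈ p, s.2.1 + s.2.2.1 + s.2.2.2 = 2)
    (huz : ∀ s ∈ u 2, s.2.2.2 ≠ 0) (htz : ∀ s ∈ t 2, s.2.2.2 ≠ 0)
    (hvz : form 1 1 0 (v 2) ≠ (0 : ℤ))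
    (hl0 : l 0 ≠ 0) (hl1 : l 1 ≠ 0)
    (h0 : (l ⨯₃ m) 0 ≠ 0) (h2 : (l ⨯₃ m) 2 ≠ 0) (hz : form (l 1) (-l 0) 0 p ≠ 0)
    (hm : form ((l ⨯₃ m) 0) ((l ⨯₃ m) 1) ((l ⨯₃ m) 2) p ≠ 0)
    (h : ∀ x y z : S3, (25 : S3) • ((fun i => form x y z (u i)) ⨯₃ fun i => form x y z (v i)) =
      form x y z (linTerms l) • fun i => form x y z ((fiberTerms n).map (derivTerm · i)))
    (hlt : ∀ x y z : S3, ∀ i, form x y z (linTerms l) * form x y z (t i) =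
      form x y z p * form x y z (u i) + z * form x y z (linTerms m) * form x y z (v i)) :
    (IsMPOGWith (fiber e) 16 8 8 ∧ IsTjurina (fiber e) 167) ∧
      IsNearlyFreeWith (X 2 * fiber e) 17 8 9 ∧ IsTjurina (X 2 * fiber e) 191 := by
  obtain ⟨hL, hLp, hK⟩ := isKoszulPair_linTerms hl0 hl1 h0 h2 hz hm
  have hlin (l : Fin 3 → ℤ) : (toPoly (linTerms l)).IsHomogeneous 1 :=
    isHomogeneous_toPoly (by simp [linTerms])
  exact isMPOGWith_of_cross (n := 7) (isHomogeneous_fiber e) (isSaturatedVec_grad_fiber e)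
    (isHomogeneous_toPoly_of_forall hu) (isHomogeneous_toPoly_of_forall hv)
    (isHomogeneous_toPoly_of_forall ht) (hlin l) (isHomogeneous_toPoly hp) (hlin m) hL hLp hK
    (cross_toPoly he h) (funext fun i => hlt (X 0) (X 1) (X 2) i) (not_X_dvd_fiber e)
    (isHomogeneous_toPoly_lowerZ huz (hu 2)) (toPoly_eq_X_two_mul huz)
    (isHomogeneous_toPoly_lowerZ htz (ht 2)) (toPoly_eq_X_two_mul htz) 
    (not_X_two_dvd_toPoly hvz) (by norm_num) (by norm_num)

theorem isMPOGWith_f0'' : (IsMPOGWith f0'' 16 8 8 ∧ IsTjurina f0'' 167) ∧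
    IsNearlyFreeWith (X 2 * f0'') 17 8 9 ∧ IsTjurina (X 2 * f0'') 191 := by
  rw [← fiber_zero]
  refine isMPOGWith_fiber (n := 0) (u := termsUZero) (v := termsVZero) (t := termsTZero)
    (p := termsPZero) (l := ![-52007943536640, -63882000000, 5335194009600])
    (m := ![-11906580480, 22500000, 2843443200]) (by simp) (by decide) (by decide) (by decide)
    (by decide) (by decide) (by decide) (by decide) (by decide) (by decide) (by decide) (by decide)
    (by decide) (by decide) (fun x y z => ?_) (fun x y z i => ?_)
  · rw [cross_apply]
    ext i : 1
    fin_cases i <;>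
    · simp [form, fiberTerms, termsF, derivTerm, linTerms, termsUZero, termsVZero]
      ring
  · fin_cases i <;>
    · simp [form, linTerms, termsUZero, termsVZero, termsTZero, termsPZero]
      ring

theorem isMPOGWith_f1'' : (IsMPOGWith f1'' 16 8 8 ∧ IsTjurina f1'' 167) ∧
    IsNearlyFreeWith (X 2 * f1'') 17 8 9 ∧ IsTjurina (X 2 * f1'') 191 := by
  rw [← fiber_neg_one]
  refine isMPOGWith_fiber (n := -25) (u := termsUOne) (v := termsVOne) (t := termsTOne)
    (p := termsPOne) (l := ![-104788001464320, -46566000000, 7839540364800])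
    (m := ![-131643217920, 90000000, 22395532800]) (by simp) (by decide) (by decide) (by decide)
    (by decide) (by decide) (by decide) (by decide) (by decide) (by decide) (by decide) (by decide)
    (by decide) (by decide) (fun x y z => ?_) (fun x y z i => ?_)
  · rw [cross_apply]
    ext i : 1
    fin_cases i <;>
    · simp [form, fiberTerms, termsF, derivTerm, linTerms, termsUOne, termsVOne]
      ring
  · fin_cases i <;>
    · simp [form, linTerms, termsUOne, termsVOne, termsTOne, termsPOne]
      ring

/-! ### The union of two members of the pencil -/

theorem grad_f0''_mul_fiber_zero (e : ℂ) :
    grad (f0'' * fiber e) 0 = (f0'' + fiber e) * grad f0'' 0 := by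
  have h := grad_fiber_zero e
  simp only [grad, Derivation.leibniz, smul_eq_mul] at h ⊢
  linear_combination f0'' * h

theorem grad_f0''_mul_fiber_one (e : ℂ) :
    grad (f0'' * fiber e) 1 = (f0'' + fiber e) * grad f0'' 1 := by
  have h := grad_fiber_one e
  simp only [grad, Derivation.leibniz, smul_eq_mul] at h ⊢
  linear_combination f0'' * h

theorem not_X_dvd_f0''_add_fiber (e : ℂ) : ¬ X 2 ∣ f0'' + fiber e := by
  refine not_X_dvd_of_eval ?_
  rw [← fiber_zero, map_add, eval_fiber, eval_fiber]
  norm_num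

theorem isHomogeneous_f0''_mul_fiber (e : ℂ) : (f0'' * fiber e).IsHomogeneous 32 :=
  isHomogeneous_f0''.mul (isHomogeneous_fiber e)

theorem isSaturatedVec_grad_f0''_mul_fiber {e : ℂ} (he : e ≠ 0) :
    IsSaturatedVec (grad (f0'' * fiber e)) := by
  have hE := (isHomogeneous_f0''_mul_fiber e).sum_X_mul_pderiv
  rw [Fin.sum_univ_three, nsmul_eq_mul] at hE
  have hz := zCoeff_spec
  have h0 := grad_f0''_mul_fiber_zero e
  have h1 := grad_f0''_mul_fiber_one e
  have he2 : C (e ^ 2)⁻¹ * (C e : S3) ^ 2 = 1 := by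
    rw [← C_pow, ← C_mul, inv_mul_cancel₀ (pow_ne_zero 2 he), C_1]
  have h8 : (8 : S3) * C 8⁻¹ = 1 := by
    rw [← map_ofNat C 8, ← C_mul, mul_inv_cancel₀ (by norm_num), C_1]
  refine isSaturatedVec_of_pow (N := 52)
    (v := fun i => C (e ^ 2)⁻¹ * ((f0'' + fiber e) * ![zCoeffX, zCoeffY, 0] i -
      C 8⁻¹ * X 2 ^ 20 * X i)) prime_X_two ?_ ?_
  · rw [h0]
    exact prime_X_two.not_dvd_mul (not_X_dvd_f0''_add_fiber e) not_X_dvd_grad_f0''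
  · rw [Matrix.vec3_dotProduct]
    simp only [Matrix.cons_val]
    have hs : (f0'' + fiber e) * (zCoeffX * grad (f0'' * fiber e) 0 +
        zCoeffY * grad (f0'' * fiber e) 1) = (f0'' + fiber e) ^ 2 * X 2 ^ 20 := by
      rw [h0, h1]
      linear_combination (f0'' + fiber e) ^ 2 * hz
    have hd : (f0'' + fiber e) ^ 2 - 4 * (f0'' * fiber e) = C e ^ 2 * X 2 ^ 32 := by
      rw [fiber]
      ring
    simp only [grad] at hs ⊢
    linear_combination C (e ^ 2)⁻¹ * hs - C (e ^ 2)⁻¹ * C 8⁻¹ * X 2 ^ 20 * hE +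
      C (e ^ 2)⁻¹ * X 2 ^ 20 * hd - C (e ^ 2)⁻¹ * X 2 ^ 20 * 4 * (f0'' * fiber e) * h8 +
      X 2 ^ 52 * he2

theorem grad_f0''_mul_fb''_two : 625 * grad (f0'' * fb'') 2 =
    toPoly (termsR 0) * grad f0'' 0 + toPoly (termsR 1) * grad f0'' 1 := by
  have key (x y z : S3) : 25 *
      (form x y z ((fiberTerms 0).map (derivTerm · 2)) * form x y z (fiberTerms 64) +
        form x y z (fiberTerms 0) * form x y z ((fiberTerms 64).map (derivTerm · 2))) =
      form x y z (termsR 0) * form x y z ((fiberTerms 0).map (derivTerm · 0)) +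
        form x y z (termsR 1) * form x y z ((fiberTerms 0).map (derivTerm · 1)) := by
    simp [form, fiberTerms, termsF, derivTerm, termsR]
    ring
  have he0 : 25 * (0 : ℂ) = (0 : ℤ) := by norm_num
  have heb : 25 * (64 / 25 : ℂ) = (64 : ℤ) := by norm_num
  have hk := key (X 0) (X 1) (X 2)
  change 25 * (toPoly _ * toPoly _ + toPoly _ * toPoly _) =
    toPoly _ * toPoly _ + toPoly _ * toPoly _ at hk
  rw [← grad_fiber he0, ← grad_fiber he0, ← grad_fiber he0, ← grad_fiber heb,
    ← fiber_eq_toPoly he0, ← fiber_eq_toPoly heb, fiber_zero] at hk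
  refine mul_left_cancel₀ (OfNat.ofNat_ne_zero 25 : (25 : S3) ≠ 0) ?_
  change 25 * (625 * grad (f0'' * fiber (64 / 25)) 2) = _
  simp only [grad, Derivation.leibniz, smul_eq_mul] at hk ⊢
  linear_combination hk

open Matrix in
theorem isFreeWith_f0''_mul_fb'' :
    (IsFreeWith (f0'' * fb'') 15 16 ∧ IsTjurina (f0'' * fb'') 721) ∧
      IsFreeWith (X 2 * (f0'' * fb'')) 15 17 ∧ IsTjurina (X 2 * (f0'' * fb'')) 769 := by
  have h0 : grad (f0'' * fb'') 0 = _ := grad_f0''_mul_fiber_zero (64 / 25)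
  have h1 : grad (f0'' * fb'') 1 = _ := grad_f0''_mul_fiber_one (64 / 25)
  have h2 := grad_f0''_mul_fb''_two
  have hC : (C 625 : S3) = 625 := map_ofNat C 625
  refine isFreeWith_of_cross (n := 14) (d₂ := 16) (c := 625) (q := 0)
    (u := ![-grad f0'' 1, grad f0'' 0, 0])
    (v := ![-toPoly (termsR 0), -toPoly (termsR 1), C 625 * (f0'' + fiber (64 / 25))])
    (isHomogeneous_f0''_mul_fiber _) (by norm_num)
    (isSaturatedVec_grad_f0''_mul_fiber (by norm_num)) (fun i => ?_) (fun i => ?_) (by norm_num)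
    ?_ (prime_X_two.not_dvd_mul ?_ (not_X_dvd_fiber _)) (isHomogeneous_zero _ _ _) (by simp)
    (prime_X_two.not_dvd_mul ?_ (not_X_dvd_f0''_add_fiber _)) (by norm_num) (by norm_num)
  · fin_cases i
    · exact isHomogeneous_f0''.pderiv.neg
    · exact isHomogeneous_f0''.pderiv
    · exact isHomogeneous_zero _ _ _
  · fin_cases i
    · exact (isHomogeneous_toPoly (by decide)).neg
    · exact (isHomogeneous_toPoly (by decide)).neg
    · exact (isHomogeneous_f0''.add (isHomogeneous_fiber _)).C_mul 625
  · rw [cross_apply]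
    ext i : 1
    fin_cases i
    · simp [h0]
      ring
    · simp [h1]
      ring
    · simp [hC, h2]
      ring
  · rw [← fiber_zero]
    exact not_X_dvd_fiber 0
  · exact not_X_dvd_of_eval (by simp)

/-- Freeness properties for the curves of degree 16 associated with a degree 16
Briançon-type polynomial, and their unions with the line at infinity `L : z = 0`. -/
theorem statement12 :
    ((IsMPOGWith f0'' 16 8 8 ∧ IsTjurina f0'' 167) ∧
      (IsMPOGWith f1'' 16 8 8 ∧ IsTjurina f1'' 167) ∧
      (IsFreeWith fb'' 7 8 ∧ IsTjurina fb'' 169)) ∧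
    ((IsFreeWith (X 2 * fb'') 7 9 ∧ IsTjurina (X 2 * fb'') 193) ∧
      (IsNearlyFreeWith (X 2 * f0'') 17 8 9 ∧ IsTjurina (X 2 * f0'') 191) ∧
      (IsNearlyFreeWith (X 2 * f1'') 17 8 9 ∧ IsTjurina (X 2 * f1'') 191)) ∧
    ((IsFreeWith (f0'' * fb'') 15 16 ∧ IsTjurina (f0'' * fb'') 721) ∧
      (IsFreeWith (X 2 * (f0'' * fb'')) 15 17 ∧ IsTjurina (X 2 * (f0'' * fb'')) 769)) := by
  obtain ⟨hb, hbL⟩ := isFreeWith_fb''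
  obtain ⟨h0, h0L⟩ := isMPOGWith_f0''
  obtain ⟨h1, h1L⟩ := isMPOGWith_f1''
  exact ⟨⟨h0, h1, hb⟩, ⟨hbL, h0L, h1L⟩, isFreeWith_f0''_mul_fb''⟩

end
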